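/- The polynomial f(x) = x^{135} − 2214 is irreducible over ℚ, and the pure number field K = ℚ(α), where α is a complex root of f, is not monogenic. -/

import Mathlib

open Polynomial

namespace Ex17

/-- The field of algebraic numbers. -/
def Om : Type := AlgebraicClosure ℚ

noncomputable instance : Field Om := inferInstanceAs (Field (AlgebraicClosure ℚ))
instance : CharZero Om := inferInstanceAs (CharZero (AlgebraicClosure ℚ))
instance : IsAlgClosed Om := inferInstanceAs (IsAlgClosed (AlgebraicClosure ℚ))
instance : Algebra.IsAlgebraic ℚ Om := by
  have h := @AlgebraicClosure.isAlgebraic ℚ _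
  have e : (AlgebraicClosure.instAlgebra ℚ : Algebra ℚ (AlgebraicClosure ℚ))
    = (inferInstance : Algebra ℚ Om) := Subsingleton.elim _ _
  rw [e] at h
  exact h
instance : IsAlgClosure ℚ Om := ⟨inferInstance, inferInstance⟩

/-- Divisibility by algebraic integers. -/
def Dv (x y : Om) : Prop := ∃ z : Om, IsIntegral ℤ z ∧ y = x * z

lemma Dv.mul_right {x y : Om} (h : Dv x y) {t : Om} (ht : IsIntegral ℤ t) : Dv x (y * t) := by
  obtain ⟨z, hz, rfl⟩ := h
  exact ⟨z * t, hz.mul ht, by ring⟩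

lemma Dv.sum {ι : Type*} (s : Finset ι) {x : Om} {f : ι → Om} (h : ∀ i ∈ s, Dv x (f i)) :
    Dv x (∑ i ∈ s, f i) := by
  classical
  induction s using Finset.induction_on with
  | empty => exact ⟨0, isIntegral_zero, by simp⟩
  | insert a s ha ih =>
    rw [Finset.sum_insert ha]
    obtain ⟨z, hz, e⟩ := h a (Finset.mem_insert_self _ _)
    obtain ⟨w, hw, e'⟩ := ih (fun i hi => h i (Finset.mem_insert_of_mem hi))
    exact ⟨z + w, hz.add hw, by rw [e, e']; ring⟩

lemma Dv.prod {ι : Type*} (s : Finset ι) {f g : ι → Om} (h : ∀ i ∈ s, Dv (f i) (g i)) :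
    Dv (∏ i ∈ s, f i) (∏ i ∈ s, g i) := by
  classical
  induction s using Finset.induction_on with
  | empty => exact ⟨1, isIntegral_one, by simp⟩
  | insert a s ha ih =>
    rw [Finset.prod_insert ha, Finset.prod_insert ha]
    obtain ⟨z, hz, e⟩ := h a (Finset.mem_insert_self _ _)
    obtain ⟨w, hw, e'⟩ := ih (fun i hi => h i (Finset.mem_insert_of_mem hi))
    exact ⟨z * w, hz.mul hw, by rw [e, e']; ring⟩

lemma isIntegral_aeval {x : Om} (hx : IsIntegral ℤ x) (p : ℤ[X]) : IsIntegral ℤ (aeval x p) := by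
  have h := (aeval (⟨x, hx⟩ : integralClosure ℤ Om) p).2
  have e := Polynomial.aeval_subalgebra_coe p (integralClosure ℤ Om) ⟨x, hx⟩
  rw [e] at h
  exact h

lemma Dv.aeval_sub {x y : Om} (hx : IsIntegral ℤ x) (hy : IsIntegral ℤ y) (p : ℤ[X]) :
    Dv (x - y) (aeval x p - aeval y p) := by
  let x' : integralClosure ℤ Om := ⟨x, hx⟩
  let y' : integralClosure ℤ Om := ⟨y, hy⟩
  have := Polynomial.sub_dvd_eval_sub x' y' (p.map (algebraMap ℤ (integralClosure ℤ Om)))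
  rw [Polynomial.eval_map_algebraMap, Polynomial.eval_map_algebraMap] at this
  obtain ⟨z, hz⟩ := this
  refine ⟨z, z.2, ?_⟩
  have h2 := congrArg (fun t : integralClosure ℤ Om => (t : Om)) hz
  simpa [x', y', Polynomial.aeval_subalgebra_coe] using h2

lemma int_of_rat {q : ℚ} (h : IsIntegral ℤ (algebraMap ℚ Om q)) : ∃ n : ℤ, q = n := by
  have h' : IsIntegral ℤ q := (isIntegral_algebraMap_iff (algebraMap ℚ Om).injective).1 h
  obtain ⟨n, hn⟩ := IsIntegrallyClosed.isIntegral_iff.1 h'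
  exact ⟨n, by simpa using hn.symm⟩

lemma int_dvd_of_integral {m n : ℤ} (hm : m ≠ 0) {z : Om} (hz : IsIntegral ℤ z)
    (h : (n : Om) = m * z) : m ∣ n := by
  have e : z = algebraMap ℚ Om ((n : ℚ) / m) := by
    have : (m : Om) ≠ 0 := by exact_mod_cast hm
    rw [map_div₀]
    simp only [map_intCast]
    rw [h]; field_simp
  rw [e] at hz
  obtain ⟨k, hk⟩ := int_of_rat hz
  refine ⟨k, ?_⟩
  have : (m : ℚ) ≠ 0 := by exact_mod_cast hm
  rw [div_eq_iff this] at hk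
  have : n = k * m := by exact_mod_cast hk
  rw [this, mul_comm]

instance : IsGalois ℚ Om := IsAlgClosure.isGalois ℚ Om

lemma int_of_fixed {z : Om} (hz : IsIntegral ℤ z) (h : ∀ σ : Om ≃ₐ[ℚ] Om, σ z = z) :
    ∃ n : ℤ, z = n := by
  have h1 : z ∈ IntermediateField.fixedField (⊥ : IntermediateField ℚ Om).fixingSubgroup := by
    rw [IntermediateField.mem_fixedField_iff]
    intro f _
    exact h f
  rw [InfiniteGalois.fixedField_fixingSubgroup, IntermediateField.mem_bot] at h1
  obtain ⟨q, rfl⟩ := h1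
  obtain ⟨n, rfl⟩ := int_of_rat hz
  exact ⟨n, by simp⟩

/-- The properties of a prime of the ring of algebraic integers over `q`, seen in `Om`. -/
structure IsPr (q : ℕ) (M : Om → Prop) : Prop where
  int : ∀ x, M x → IsIntegral ℤ x
  q_mem : M q
  add : ∀ x y, M x → M y → M (x + y)
  mul : ∀ x y, IsIntegral ℤ x → M y → M (x * y)
  prime : ∀ x y, IsIntegral ℤ x → IsIntegral ℤ y → M (x * y) → M x ∨ M y
  dvd : ∀ n : ℤ, M n → (q : ℤ) ∣ n

lemma exists_pr (q : ℕ) (hq : q.Prime) : ∃ M : Om → Prop, IsPr q M := by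
  let O := integralClosure ℤ Om
  have hne : Ideal.span {((q : ℕ) : O)} ≠ ⊤ := by
    intro h
    rw [Ideal.span_singleton_eq_top] at h
    obtain ⟨u, hu⟩ := h.exists_right_inv
    have h2 := congrArg (fun t : O => (t : Om)) hu
    simp at h2
    have := int_dvd_of_integral (m := q) (n := 1) (by exact_mod_cast hq.ne_zero) u.2
      (by push_cast; exact h2.symm)
    have : q ∣ 1 := by exact_mod_cast this
    exact hq.one_lt.ne' (Nat.dvd_one.1 this)
  obtain ⟨m, hm, hle⟩ := Ideal.exists_le_maximal _ hne
  have hqm : ((q : ℕ) : O) ∈ m := hle (Ideal.mem_span_singleton_self _)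
  refine ⟨fun x => ∃ w : O, w ∈ m ∧ (w : Om) = x, ?_, ?_, ?_, ?_, ?_, ?_⟩
  · rintro x ⟨w, _, rfl⟩; exact w.2
  · exact ⟨_, hqm, by simp⟩
  · rintro x y ⟨w, hw, rfl⟩ ⟨v, hv, rfl⟩
    exact ⟨w + v, m.add_mem hw hv, by simp⟩
  · rintro x y hx ⟨v, hv, rfl⟩
    exact ⟨(⟨x, hx⟩ : O) * v, m.mul_mem_left _ hv, by simp⟩
  · rintro x y hx hy ⟨v, hv, e⟩
    have : v = (⟨x, hx⟩ : O) * ⟨y, hy⟩ := Subtype.ext (by simpa using e)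
    rw [this] at hv
    rcases hm.isPrime.mem_or_mem hv with h | h
    · exact Or.inl ⟨_, h, rfl⟩
    · exact Or.inr ⟨_, h, rfl⟩
  · rintro n ⟨w, hw, e⟩
    have hwn : w = (n : O) := Subtype.ext (by simpa using e)
    rw [hwn] at hw
    by_contra hnd
    have hc : IsCoprime (q : ℤ) n := (Nat.prime_iff_prime_int.1 hq).coprime_iff_not_dvd.2 hnd
    obtain ⟨a, b, hab⟩ := hc
    apply hm.ne_top
    rw [Ideal.eq_top_iff_one]
    have : (1 : O) = a * (q : ℕ) + b * n := by
      have := congrArg (fun t : ℤ => (t : O)) hab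
      push_cast at this
      exact this.symm
    rw [this]
    exact m.add_mem (m.mul_mem_left _ hqm) (m.mul_mem_left _ hw)

namespace IsPr
variable {q : ℕ} {M : Om → Prop}

lemma zero (h : IsPr q M) : M 0 := by
  have := h.mul 0 _ isIntegral_zero h.q_mem
  simpa using this

lemma neg (h : IsPr q M) {x : Om} (hx : M x) : M (-x) := by
  have := h.mul (-1) _ (isIntegral_one.neg) hx
  simpa using this

lemma sub (h : IsPr q M) {x y : Om} (hx : M x) (hy : M y) : M (x - y) := by
  rw [sub_eq_add_neg]; exact h.add _ _ hx (h.neg hy)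

lemma not_one (h : IsPr q M) (hq : q.Prime) : ¬ M 1 := by
  intro h1
  have := h.dvd 1 (by simpa using h1)
  have : q ∣ 1 := by exact_mod_cast this
  exact hq.one_lt.ne' (Nat.dvd_one.1 this)

lemma of_pow (h : IsPr q M) (hq : q.Prime) {x : Om} (hx : IsIntegral ℤ x) {n : ℕ}
    (hn : M (x ^ n)) : M x := by
  induction n with
  | zero => exact absurd (by simpa using hn) (h.not_one hq)
  | succ n ih =>
    rw [pow_succ] at hn
    rcases h.prime _ _ (hx.pow n) hx hn with h' | h'
    · exact ih h'
    · exact h'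

lemma of_prod (h : IsPr q M) (hq : q.Prime) {ι : Type*} (s : Finset ι) {f : ι → Om}
    (hf : ∀ i ∈ s, IsIntegral ℤ (f i)) (hM : M (∏ i ∈ s, f i)) : ∃ i ∈ s, M (f i) := by
  classical
  induction s using Finset.induction_on with
  | empty => exact absurd (by simpa using hM) (h.not_one hq)
  | insert a s ha ih =>
    rw [Finset.prod_insert ha] at hM
    have hi : ∀ i ∈ s, IsIntegral ℤ (f i) := fun i hi => hf i (Finset.mem_insert_of_mem hi)
    rcases h.prime _ _ (hf a (Finset.mem_insert_self _ _)) (IsIntegral.prod _ hi) hM with h' | h'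
    · exact ⟨a, Finset.mem_insert_self _ _, h'⟩
    · obtain ⟨i, hi, hm⟩ := ih hi h'
      exact ⟨i, Finset.mem_insert_of_mem hi, hm⟩

/-- congruent to an integer: products -/
lemma prod_sub (h : IsPr q M) {ι : Type*} (s : Finset ι) {f g : ι → Om}
    (hf : ∀ i ∈ s, IsIntegral ℤ (f i)) (hg : ∀ i ∈ s, IsIntegral ℤ (g i))
    (hM : ∀ i ∈ s, M (f i - g i)) :
    M (∏ i ∈ s, f i - ∏ i ∈ s, g i) := by
  classical
  induction s using Finset.induction_on with
  | empty => simpa using h.zero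
  | insert a s ha ih =>
    rw [Finset.prod_insert ha, Finset.prod_insert ha]
    have hi : ∀ i ∈ s, IsIntegral ℤ (f i) := fun i hi => hf i (Finset.mem_insert_of_mem hi)
    have e : f a * ∏ i ∈ s, f i - g a * ∏ i ∈ s, g i
      = f a * (∏ i ∈ s, f i - ∏ i ∈ s, g i) + (∏ i ∈ s, g i) * (f a - g a) := by ring
    rw [e]
    refine h.add _ _ (h.mul _ _ (hf a (Finset.mem_insert_self _ _)) (ih hi
      (fun i hi => hg i (Finset.mem_insert_of_mem hi)) (fun i hi => hM i (Finset.mem_insert_of_mem hi))))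
      (h.mul _ _ (IsIntegral.prod _ (fun i hi => hg i (Finset.mem_insert_of_mem hi))) (hM a (Finset.mem_insert_self _ _)))

lemma aeval_sub_eval (h : IsPr q M) {x : Om} (hx : IsIntegral ℤ x) (m : ℤ) (hM : M (x - m)) (p : ℤ[X]) :
    M (aeval x p - (p.eval m : ℤ)) := by
  obtain ⟨z, hz, e⟩ := Dv.aeval_sub hx (isIntegral_algebraMap (x := m) (A := Om)) p
  have : (aeval (algebraMap ℤ Om m) p : Om) = ((p.eval m : ℤ) : Om) := by
    rw [aeval_algebraMap_apply]; simp
  rw [this] at e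
  rw [e, mul_comm]
  exact h.mul _ _ hz (by simpa using hM)

lemma taylor (h : IsPr q M) {x y : Om} (hx : M x) (hy : M y) (p : ℤ[X]) :
    ∃ r : Om, IsIntegral ℤ r ∧ aeval x p - aeval y p = (x - y) * r ∧ M (r - (p.coeff 1 : ℤ)) := by
  induction p using Polynomial.induction_on' with
  | add p p' hp hp' =>
    obtain ⟨r, hr, e, hm⟩ := hp
    obtain ⟨r', hr', e', hm'⟩ := hp'
    refine ⟨r + r', hr.add hr', ?_, ?_⟩
    · rw [map_add, map_add, mul_add, ← e, ← e']; ring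
    · have := h.add _ _ hm hm'
      rw [coeff_add]; push_cast
      convert this using 1; ring
  | monomial n a =>
    have ia : IsIntegral ℤ (a : Om) := by
      simpa using (isIntegral_algebraMap (x := a) (A := Om) : IsIntegral ℤ (algebraMap ℤ Om a))
    rcases n with _ | _ | n
    · exact ⟨0, isIntegral_zero, by simp, by
        rw [monomial_zero_left, coeff_C]; simpa using h.zero⟩
    · refine ⟨a, ia, by simp [aeval_monomial]; ring, by simpa [coeff_monomial] using h.zero⟩
    · have ix := h.int _ hx
      have iy := h.int _ hy
      refine ⟨a * ∑ i ∈ Finset.range (n+2), x ^ i * y ^ (n + 1 - i), ?_, ?_, ?_⟩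
      · exact ia.mul (IsIntegral.sum _ (fun i _ => (ix.pow _).mul (iy.pow _)))
      · have := (Commute.all x y).mul_geom_sum₂ (n+2)
        simp only [aeval_monomial]
        simp only [eq_intCast]
        have e : ∀ i, n + 2 - 1 - i = n + 1 - i := fun i => by omega
        simp only [e] at this
        have h2 : (a:Om) * x ^ (n+1+1) - a * y ^ (n+1+1) = a * (x ^ (n+2) - y^(n+2)) := by ring
        rw [h2, ← this]; ring
      · have e0 : (monomial (n+1+1) a).coeff 1 = 0 := by rw [coeff_monomial]; simp
        rw [e0]
        simp only [Int.cast_zero, sub_zero]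
        refine h.mul _ _ ia ?_
        apply Finset.sum_induction _ M h.add h.zero
        intro i _
        rcases i with _ | i
        · rw [Nat.sub_zero, pow_succ y n, ← mul_assoc]
          exact h.mul _ _ ((ix.pow _).mul (iy.pow _)) hy
        · have : x ^ (i+1) * y ^ (n+1-(i+1)) = (x ^ i * y ^ (n+1-(i+1))) * x := by ring
          rw [this]
          exact h.mul _ _ ((ix.pow _).mul (iy.pow _)) hx
end IsPr
end Ex17

namespace Ex17

/-- `q`-maximality of `ℤ[x]`. -/
def Mx (q : ℕ) (x : Om) : Prop :=
  ∀ r : ℤ[X], IsIntegral ℤ (aeval x r / (q : Om)) → ∃ s : ℤ[X], aeval x r = q * aeval x s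

lemma lift_eq {q : ℕ} {r r' : ℤ[X]} (h : r.map (Int.castRingHom (ZMod q)) = r'.map (Int.castRingHom (ZMod q))) :
    ∃ s : ℤ[X], r = r' + C (q : ℤ) * s := by
  have : C (q : ℤ) ∣ r - r' := by
    rw [C_dvd_iff_dvd_coeff]
    intro i
    have := congrArg (fun p => p.coeff i) h
    simp only [coeff_map, eq_intCast] at this
    rw [coeff_sub]
    exact (ZMod.intCast_eq_intCast_iff_dvd_sub _ _ _).1 this.symm
  obtain ⟨s, hs⟩ := this
  exact ⟨s, by rw [← hs]; ring⟩

lemma ufd_aux {R : Type*} [CommRing R] [IsDomain R] [UniqueFactorizationMonoid R] {x y d : R}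
    (hx : Prime x) (hy : Prime y) (hxy : ¬ x ∣ y) (hyx : ¬ y ∣ x) (a b : ℕ) (h : d ∣ x ^ a * y ^ b) :
    x ^ a * y ^ b ∣ d ∨ (∃ a', a = a' + 1 ∧ d ∣ x ^ a' * y ^ b) ∨
      (∃ b', b = b' + 1 ∧ d ∣ x ^ a * y ^ b') := by
  obtain ⟨e, he⟩ := h
  by_cases hu : IsUnit e
  · left
    rw [he]
    exact (IsUnit.mul_right_dvd hu).2 dvd_rfl
  right
  have he0 : e ≠ 0 := by
    rintro rfl
    rw [mul_zero] at he
    exact mul_ne_zero (pow_ne_zero _ hx.ne_zero) (pow_ne_zero _ hy.ne_zero) he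
  obtain ⟨π, hπ, hπe⟩ := WfDvdMonoid.exists_irreducible_factor hu he0
  have hp := hπ.prime
  have h1 : π ∣ x ^ a * y ^ b := by rw [he]; exact hπe.mul_left d
  rcases hp.dvd_or_dvd h1 with h1 | h1
  · left
    have hx' : x ∣ e := ((hp.dvd_prime_iff_associated hx).1 (hp.dvd_of_dvd_pow h1)).symm.dvd.trans hπe
    obtain ⟨f, rfl⟩ := hx'
    rcases a with _ | a
    · exfalso
      rw [pow_zero, one_mul] at he
      exact hxy (hx.dvd_of_dvd_pow (n := b) (by rw [he]; exact ⟨d * f, by ring⟩))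
    · refine ⟨a, rfl, f, ?_⟩
      apply mul_left_cancel₀ hx.ne_zero
      rw [← mul_assoc, ← pow_succ', he]; ring
  · right
    have hx' : y ∣ e := ((hp.dvd_prime_iff_associated hy).1 (hp.dvd_of_dvd_pow h1)).symm.dvd.trans hπe
    obtain ⟨f, rfl⟩ := hx'
    rcases b with _ | b
    · exfalso
      rw [pow_zero, mul_one] at he
      exact hyx (hy.dvd_of_dvd_pow (n := a) (by rw [he]; exact ⟨d * f, by ring⟩))
    · refine ⟨b, rfl, f, ?_⟩
      apply mul_left_cancel₀ hy.ne_zero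
      have : y * (x ^ a * y ^ b) = x ^ a * y ^ (b+1) := by ring
      rw [this, he]; ring

lemma isIntegral_int (n : ℤ) : IsIntegral ℤ (n : Om) := by
  simpa using (isIntegral_algebraMap (x := n) (A := Om) : IsIntegral ℤ (algebraMap ℤ Om n))

theorem dedekind {q : ℕ} (hq : q.Prime) (a b : ℕ) (k : ℤ[X]) {x : Om} (ix : IsIntegral ℤ x)
    (hx : x ^ a * (x - 1) ^ b + q * aeval x k = 0)
    (h0 : ∀ a', a = a' + 1 → ¬ IsIntegral ℤ (x ^ a' * (x - 1) ^ b / (q : Om)))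
    (h1 : ∀ b', b = b' + 1 → ¬ IsIntegral ℤ (x ^ a * (x - 1) ^ b' / (q : Om))) : Mx q x := by
  have : Fact q.Prime := ⟨hq⟩
  have hq0 : (q : Om) ≠ 0 := by exact_mod_cast hq.ne_zero
  let φ := Polynomial.mapRingHom (Int.castRingHom (ZMod q))
  have φs : Function.Surjective φ := Polynomial.map_surjective _ ZMod.intCast_surjective
  let I0 : Ideal ℤ[X] :=
    { carrier := {r | IsIntegral ℤ (aeval x r / (q : Om))}
      add_mem' := by
        intro r s hr hs
        simp only [Set.mem_ofPred_eq, map_add, add_div] at *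
        exact hr.add hs
      zero_mem' := by simp [isIntegral_zero]
      smul_mem' := by
        intro c r hr
        simp only [Set.mem_ofPred_eq, smul_eq_mul, map_mul, mul_div_assoc] at *
        exact (isIntegral_aeval ix c).mul hr }
  have key : ∀ r r' : ℤ[X], r ∈ I0 → φ r = φ r' → IsIntegral ℤ (aeval x r' / (q : Om)) := by
    intro r r' hr h
    obtain ⟨s, hs⟩ := lift_eq (q := q) h.symm
    rw [hs]
    have : aeval x (r + C (q : ℤ) * s) / (q : Om) = aeval x r / q + aeval x s := by
      simp; field_simp
    rw [this]
    exact IsIntegral.add hr (isIntegral_aeval ix s)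
  have hI : ∀ r' : ℤ[X], φ r' ∈ I0.map φ → IsIntegral ℤ (aeval x r' / (q : Om)) := by
    intro r' h
    rw [Ideal.mem_map_iff_of_surjective φ φs] at h
    obtain ⟨r, hr, e⟩ := h
    exact key r r' hr e
  obtain ⟨d, hd⟩ := (IsPrincipalIdealRing.principal (I0.map φ)).principal
  have hmem : ∀ r : ℤ[X], d ∣ φ r → IsIntegral ℤ (aeval x r / (q : Om)) := by
    intro r h
    apply hI
    rw [hd]
    exact Ideal.mem_span_singleton.2 h
  have hφ : ∀ a b : ℕ, φ (X ^ a * (X - 1) ^ b) = X ^ a * (X - C 1) ^ b := by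
    intro a b; simp [φ]
  have hpI : d ∣ X ^ a * (X - C 1) ^ b := by
    rw [← hφ, ← Ideal.mem_span_singleton]
    change _ ∈ Submodule.span _ {d}
    rw [← hd]
    apply Ideal.mem_map_of_mem
    change IsIntegral ℤ _
    have : aeval x ((X : ℤ[X]) ^ a * (X - 1) ^ b) / (q : Om) = - aeval x k := by
      simp only [map_mul, map_pow, map_sub, aeval_X, map_one]
      rw [div_eq_iff hq0]
      linear_combination hx
    rw [this]
    exact (isIntegral_aeval ix k).neg
  have nd : ∀ u v : ZMod q, u ≠ v → ¬ (X - C u) ∣ (X - C v) := by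
    intro u v huv h
    rw [dvd_iff_isRoot] at h
    simp [sub_eq_zero] at h
    exact huv h
  have n1 := nd 0 1 (by simp)
  have n2 := nd 1 0 (by simp)
  simp only [map_zero, sub_zero] at n1 n2
  rcases ufd_aux (Polynomial.prime_X) (Polynomial.prime_X_sub_C (1 : ZMod q)) n1 n2 a b hpI with h | ⟨a', ha, h⟩ | ⟨b', hb, h⟩
  · intro r hr
    have hr' : d ∣ φ r := by
      rw [← Ideal.mem_span_singleton]
      change _ ∈ Submodule.span _ {d}
      rw [← hd]
      exact Ideal.mem_map_of_mem _ hr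
    obtain ⟨t, ht⟩ := h.trans hr'
    obtain ⟨t', rfl⟩ := φs t
    rw [← hφ, ← map_mul] at ht
    obtain ⟨s, hs⟩ := lift_eq (q := q) ht
    refine ⟨s - k * t', ?_⟩
    rw [hs]
    simp only [map_add, map_mul, map_pow, map_sub, aeval_X, map_one, aeval_C]
    simp only [eq_intCast, Int.cast_natCast]
    linear_combination (aeval x t') * hx
  · have h2 := hmem (X ^ a' * (X - 1) ^ b) (by rw [hφ]; exact h)
    simp only [map_mul, map_pow, map_sub, aeval_X, map_one] at h2
    exact absurd h2 (h0 a' ha)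
  · have h2 := hmem (X ^ a * (X - 1) ^ b') (by rw [hφ]; exact h)
    simp only [map_mul, map_pow, map_sub, aeval_X, map_one] at h2
    exact absurd h2 (h1 b' hb)

theorem denom {q : ℕ} (hq : q.Prime) {x z : Om} (hM : Mx q x) (hz : IsIntegral ℤ z) (P : ℚ[X])
    (hP : z = aeval x P) : ∃ n : ℤ, ¬ (q : ℤ) ∣ n ∧ ∃ s : ℤ[X], n * z = aeval x s := by
  have hq0 : (q : Om) ≠ 0 := by exact_mod_cast hq.ne_zero
  have step : ∀ N : ℕ, ∀ D : ℤ, D ≠ 0 → D.natAbs = N → (∃ s : ℤ[X], D * z = aeval x s) →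
      ∃ n : ℤ, ¬ (q : ℤ) ∣ n ∧ ∃ s : ℤ[X], n * z = aeval x s := by
    intro N
    induction N using Nat.strong_induction_on with
    | _ N ih =>
      intro D hD hN ⟨s, hs⟩
      by_cases hd : (q : ℤ) ∣ D
      · obtain ⟨D', rfl⟩ := hd
        have hD' : D' ≠ 0 := by rintro rfl; simp at hD
        have e : aeval x s / (q : Om) = D' * z := by
          rw [← hs]; push_cast; field_simp
        obtain ⟨s', hs'⟩ := hM s (by rw [e]; exact (isIntegral_int _).mul hz)
        refine ih D'.natAbs ?_ D' hD' rfl ⟨s', ?_⟩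
        · rw [← hN, Int.natAbs_mul, Int.natAbs_natCast]
          have := hq.one_lt
          have h2 : 0 < D'.natAbs := Int.natAbs_pos.2 hD'
          nlinarith
        · rw [← e, hs']; field_simp
      · exact ⟨D, hd, s, hs⟩
  obtain ⟨b, hb, e⟩ := IsLocalization.integerNormalization_spec (nonZeroDivisors ℤ) P
  refine step _ b (nonZeroDivisors.ne_zero hb) rfl ⟨IsLocalization.integerNormalization (nonZeroDivisors ℤ) P, ?_⟩
  rw [← aeval_map_algebraMap ℚ, e, hP]
  simp

open Classical in
/-- The finite set of `n`-th roots. -/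
noncomputable def rt (n : ℕ) (c : Om) : Finset Om := (nthRoots n c).toFinset

lemma mem_rt {n : ℕ} (hn : 0 < n) {c s : Om} : s ∈ rt n c ↔ s ^ n = c := by
  simp [rt, mem_nthRoots hn]

lemma prod_rt {n : ℕ} (hn : 0 < n) {c : Om} (hc : c ≠ 0) :
    ∏ s ∈ rt n c, (X - C s) = X ^ n - C c := by
  classical
  have hs : (X ^ n - C c : Om[X]).Separable :=
    separable_X_pow_sub_C c (by exact_mod_cast hn.ne') hc
  have hnd : (nthRoots n c).Nodup := nodup_roots hs
  have h2 := (IsAlgClosed.splits (X ^ n - C c : Om[X])).eq_prod_roots_of_monic (monic_X_pow_sub_C c hn.ne')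
  rw [h2]
  rw [Finset.prod, rt, Multiset.toFinset_val, hnd.dedup]
  rfl

lemma card_rt {n : ℕ} (hn : 0 < n) {c : Om} (hc : c ≠ 0) : (rt n c).card = n := by
  have := congrArg natDegree (prod_rt hn hc)
  rw [natDegree_prod_of_monic _ _ (fun i _ => monic_X_sub_C i), natDegree_X_pow_sub_C] at this
  simpa using this

lemma prod_sub_rt {n : ℕ} (hn : 0 < n) {c : Om} (hc : c ≠ 0) (x : Om) :
    ∏ s ∈ rt n c, (x - s) = x ^ n - c := by
  have := congrArg (eval x) (prod_rt hn hc)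
  simpa [eval_prod] using this

lemma irr_Zg {n : ℕ} (hn0 : 0 < n) {m : ℤ} (h2 : 2 ∣ m) (h4 : ¬ 4 ∣ m) :
    Irreducible ((X : ℤ[X]) ^ n - C m) := by
  have hp : (Ideal.span {(2 : ℤ)}).IsPrime := by
    rw [Ideal.span_singleton_prime (by norm_num)]; exact Int.prime_two
  apply Polynomial.irreducible_of_eisenstein_criterion hp
  · rw [leadingCoeff_X_pow_sub_C hn0]
    rw [Ideal.mem_span_singleton]; norm_num
  · intro i hn
    rw [degree_X_pow_sub_C hn0] at hn
    have hn' : i < n := by exact_mod_cast hn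
    rw [coeff_sub, coeff_X_pow, coeff_C, if_neg hn'.ne, Ideal.mem_span_singleton]
    split_ifs
    · simpa using h2
    · simp
  · rw [degree_X_pow_sub_C hn0]; exact_mod_cast hn0
  · rw [Ideal.span_singleton_pow, Ideal.mem_span_singleton]
    rw [coeff_sub, coeff_X_pow, coeff_C, if_neg hn0.ne, if_pos rfl, zero_sub, dvd_neg]
    norm_num
    exact h4
  · exact (monic_X_pow_sub_C _ hn0.ne').isPrimitive

lemma irr_Qg {n : ℕ} (hn0 : 0 < n) {m : ℤ} (h2 : 2 ∣ m) (h4 : ¬ 4 ∣ m) :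
    Irreducible (((X : ℤ[X]) ^ n - C m).map (Int.castRingHom ℚ)) :=
  ((monic_X_pow_sub_C m hn0.ne').irreducible_iff_irreducible_map_fraction_map (K := ℚ)).1
    (irr_Zg hn0 h2 h4)

lemma irr_Q : Irreducible (((X : ℤ[X]) ^ 135 - C 2214).map (Int.castRingHom ℚ)) :=
  irr_Qg (by norm_num) (by norm_num) (by norm_num)

lemma minpoly_Sg {n : ℕ} (hn0 : 0 < n) {m : ℤ} (h2 : 2 ∣ m) (h4 : ¬ 4 ∣ m) {a : Om} (ha : a ^ n = m) :
    minpoly ℚ a = (X : ℚ[X]) ^ n - C (m : ℚ) := by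
  symm
  have h := irr_Qg hn0 h2 h4
  rw [Polynomial.map_sub, Polynomial.map_pow, map_X, map_C] at h
  apply minpoly.eq_of_irreducible_of_monic (by simpa using h)
  · simp [ha]
  · exact monic_X_pow_sub_C _ hn0.ne'

lemma conj_g {n : ℕ} (hn0 : 0 < n) {m : ℤ} (h2 : 2 ∣ m) (h4 : ¬ 4 ∣ m) {a b : Om} (ha : a ^ n = m)
    (hb : b ^ n = m) : ∃ σ : Om ≃ₐ[ℚ] Om, σ a = b := by
  apply minpoly.exists_algEquiv_of_root' (Algebra.IsAlgebraic.isAlgebraic a)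
  rw [minpoly_Sg hn0 h2 h4 ha]
  simp [hb]

lemma conj {a b : Om} (ha : a ^ 135 = 2214) (hb : b ^ 135 = 2214) : ∃ σ : Om ≃ₐ[ℚ] Om, σ a = b :=
  conj_g (n := 135) (m := 2214) (by norm_num) (by norm_num) (by norm_num) (by rw [ha]; norm_num)
    (by rw [hb]; norm_num)

lemma integral_S {n : ℕ} (hn : 0 < n) {a : Om} (ha : a ^ n = 2214) : IsIntegral ℤ a := by
  refine IsIntegral.of_pow hn ?_
  rw [ha]
  exact_mod_cast isIntegral_int 2214

/-- Eisenstein primes -/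
lemma eis {q n : ℕ} (hq : q.Prime) (hn : 0 < n) (m : ℤ) (hm : (q : ℤ) * m = 2214) (hqm : ¬ (q : ℤ) ∣ m) {x : Om}
    (hx : x ^ n = 2214) : Mx q x := by
  have ix := integral_S hn hx
  have hq0 : (q : Om) ≠ 0 := by exact_mod_cast hq.ne_zero
  have hm' : (q : Om) * m = 2214 := by exact_mod_cast hm
  refine dedekind hq n 0 (C (-m)) ix ?_ ?_ (by intro b hb; omega)
  · simp [hx]
    rw [hm']; ring
  · rintro a rfl hi
    obtain ⟨M, hM⟩ := exists_pr q hq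
    have hxM : M x := by
      apply hM.of_pow hq ix (n := a + 1)
      rw [hx, ← hm', mul_comm]
      exact hM.mul _ _ (isIntegral_int _) hM.q_mem
    apply hqm
    apply hM.dvd
    have : (m : Om) = (x ^ a * (x - 1) ^ 0 / q) * x := by
      field_simp
      rw [mul_comm _ (q : Om), hm', ← pow_succ, hx]
    rw [this]
    exact hM.mul _ _ hi hxM

end Ex17

namespace Ex17

/-- An auxiliary element, generating a 3-maximal order of the nonic field. -/
noncomputable def ph (c : Om) : Om := (1/3) * c ^ 0 + (-1) * c ^ 1 + (1/3) * c ^ 2 + (1/9) * c ^ 3 + (-1/9) * c ^ 5 + (1/27) * c ^ 6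

/-- Remainder of the defining polynomial of `ph`. -/
noncomputable def kk : ℤ[X] := C (5556575) * X ^ 0 + C (8695365) * X ^ 1 + C (-7156668) * X ^ 2 + C (1375228) * X ^ 3 + C (81276) * X ^ 4 + C (-9144) * X ^ 5 + C (-107) * X ^ 6 + C (-27) * X ^ 7

/-- Matrix of the powers of `ph` in a local integral basis. -/
def AA : Matrix (Fin 9) (Fin 9) ℤ :=
  !![1, 0, 0, 0, 0, 0, 0, 0, 0;
    0, -1, 0, 0, 0, -1, 1, 0, 0;
    16, 28, -17, 5, 1, 0, 7, -4, 0;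
    206, -78, -87, 277, -75, -9, -53, 69, -18;
    14121, -824, 340, -2178, 665, 87, 520, 212, -451;
    -68847, 5554, -18093, -4203, 16856, -32649, 18022, -1313, 1855;
    -1365483, 1396404, -432567, 180882, -61236, 59958, 71260, -7944, -10722;
    13573926, -2542272, -1545498, 5127489, -887976, 1621461, -5633969, 2673581, -616227;
    159726345, -36371226, 57218478, -119209560, 30860412, -17293149, 15014632, 12756718, -9962795]

/-- The inverse of `AA` mod 3. -/
def AI : Matrix (Fin 9) (Fin 9) (ZMod 3) :=
  !![1, 0, 0, 0, 0, 0, 0, 0, 0;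
    0, 0, 2, 2, 1, 1, 2, 1, 0;
    0, 0, 0, 0, 1, 2, 1, 0, 2;
    1, 0, 0, 1, 0, 0, 2, 0, 0;
    0, 0, 2, 2, 1, 0, 2, 1, 1;
    0, 2, 1, 1, 2, 2, 2, 2, 0;
    0, 0, 0, 0, 0, 0, 1, 0, 0;
    0, 0, 0, 0, 0, 0, 1, 2, 0;
    0, 0, 0, 0, 0, 0, 1, 1, 1]

/-- The local integral basis. -/
def EE : Matrix (Fin 9) (Fin 9) ℚ :=
  !![1, 0, 0, 0, 0, 0, 0, 0, 0;
    0, 1, 0, 0, 0, 0, 0, 0, 0;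
    0, 0, 1, 0, 0, 0, 0, 0, 0;
    0, 0, 0, 1/3, 0, 0, 0, 0, 0;
    0, 0, 0, 0, 1/3, 0, 0, 0, 0;
    0, 0, -1/3, 0, 0, 1/9, 0, 0, 0;
    1/3, 0, 0, 1/9, 0, 0, 1/27, 0, 0;
    0, 1/3, 0, 0, 1/9, 0, 0, 1/27, 0;
    0, 0, 1/3, 0, 0, 1/9, 0, 0, 1/27]

lemma ph_pow {c : Om} (hc : c ^ 9 = 2214) :
    ph c ^ 2 = (55/3) * c ^ 0 + (80/3) * c ^ 1 + (-17) * c ^ 2 + (22/9) * c ^ 3 + (-1/9) * c ^ 4 + (7/27) * c ^ 6 + (-4/27) * c ^ 7 ∧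
    ph c ^ 3 = (565/3) * c ^ 0 + (-55) * c ^ 1 + (-90) * c ^ 2 + (778/9) * c ^ 3 + (-52/3) * c ^ 4 + (-3) * c ^ 5 + (-53/27) * c ^ 6 + (23/9) * c ^ 7 + (-2/3) * c ^ 8 ∧
    ph c ^ 4 = (42883/3) * c ^ 0 + (-2260/3) * c ^ 1 + (482/3) * c ^ 2 + (-6014/9) * c ^ 3 + (2207/9) * c ^ 4 + (-364/9) * c ^ 5 + (520/27) * c ^ 6 + (212/27) * c ^ 7 + (-451/27) * c ^ 8 ∧
    ph c ^ 5 = (-188519/3) * c ^ 0 + (15349/3) * c ^ 1 + (-19775/3) * c ^ 2 + (5413/9) * c ^ 3 + (49255/9) * c ^ 4 + (-30794/9) * c ^ 5 + (18022/27) * c ^ 6 + (-1313/27) * c ^ 7 + (1855/27) * c ^ 8 ∧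
    ph c ^ 6 = (-4025189/3) * c ^ 0 + (1393756) * c ^ 1 + (-456127) * c ^ 2 + (613906/9) * c ^ 3 + (-63884/3) * c ^ 4 + (16412/3) * c ^ 5 + (71260/27) * c ^ 6 + (-2648/9) * c ^ 7 + (-3574/9) * c ^ 8 ∧
    ph c ^ 7 = (35087809/3) * c ^ 0 + (-4953235/3) * c ^ 1 + (-2291394) * c ^ 2 + (9748498/9) * c ^ 3 + (9653/9) * c ^ 4 + (335078/3) * c ^ 5 + (-5633969/27) * c ^ 6 + (2673581/27) * c ^ 7 + (-205409/9) * c ^ 8 ∧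
    ph c ^ 8 = (494193667/3) * c ^ 0 + (-96356960/3) * c ^ 1 + (178985788/3) * c ^ 2 + (-342614048/9) * c ^ 3 + (105337954/9) * c ^ 4 + (-27255944/9) * c ^ 5 + (15014632/27) * c ^ 6 + (12756718/27) * c ^ 7 + (-9962795/27) * c ^ 8 ∧
    ph c ^ 9 = (-13930466597/3) * c ^ 0 + (1373215533) * c ^ 1 + (-368987343) * c ^ 2 + (-1218438719/9) * c ^ 3 + (187802924) * c ^ 4 + (-67334849) * c ^ 5 + (338994163/27) * c ^ 6 + (-23778940/3) * c ^ 7 + (17078725/3) * c ^ 8 := by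
  have h1 : ph c = (1/3) * c ^ 0 + (-1) * c ^ 1 + (1/3) * c ^ 2 + (1/9) * c ^ 3 + (-1/9) * c ^ 5 + (1/27) * c ^ 6 := rfl
  have h2 : ph c ^ 2 = (55/3) * c ^ 0 + (80/3) * c ^ 1 + (-17) * c ^ 2 + (22/9) * c ^ 3 + (-1/9) * c ^ 4 + (7/27) * c ^ 6 + (-4/27) * c ^ 7 := by
    rw [pow_two, h1]
    linear_combination ((2/243) * c ^ 0 + (1/81) * c ^ 1 + (-2/243) * c ^ 2 + (1/729) * c ^ 3) * hc
  have h3 : ph c ^ 3 = (565/3) * c ^ 0 + (-55) * c ^ 1 + (-90) * c ^ 2 + (778/9) * c ^ 3 + (-52/3) * c ^ 4 + (-3) * c ^ 5 + (-53/27) * c ^ 6 + (23/9) * c ^ 7 + (-2/3) * c ^ 8 := by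
    rw [pow_succ, h2]
    rw [h1]
    linear_combination ((20/243) * c ^ 0 + (-5/243) * c ^ 1 + (-7/243) * c ^ 2 + (19/729) * c ^ 3 + (-4/729) * c ^ 4) * hc
  have h4 : ph c ^ 4 = (42883/3) * c ^ 0 + (-2260/3) * c ^ 1 + (482/3) * c ^ 2 + (-6014/9) * c ^ 3 + (2207/9) * c ^ 4 + (-364/9) * c ^ 5 + (520/27) * c ^ 6 + (212/27) * c ^ 7 + (-451/27) * c ^ 8 := by
    rw [pow_succ, h3]
    rw [h1]
    linear_combination ((1562/243) * c ^ 0 + (-20/81) * c ^ 1 + (8/243) * c ^ 2 + (-260/729) * c ^ 3 + (41/243) * c ^ 4 + (-2/81) * c ^ 5) * hc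
  have h5 : ph c ^ 5 = (-188519/3) * c ^ 0 + (15349/3) * c ^ 1 + (-19775/3) * c ^ 2 + (5413/9) * c ^ 3 + (49255/9) * c ^ 4 + (-30794/9) * c ^ 5 + (18022/27) * c ^ 6 + (-1313/27) * c ^ 7 + (1855/27) * c ^ 8 := by
    rw [pow_succ, h4]
    rw [h1]
    linear_combination ((-7420/243) * c ^ 0 + (2158/243) * c ^ 1 + (-445/81) * c ^ 2 + (-116/729) * c ^ 3 + (1565/729) * c ^ 4 + (-451/729) * c ^ 5) * hc
  have h6 : ph c ^ 6 = (-4025189/3) * c ^ 0 + (1393756) * c ^ 1 + (-456127) * c ^ 2 + (613906/9) * c ^ 3 + (-63884/3) * c ^ 4 + (16412/3) * c ^ 5 + (71260/27) * c ^ 6 + (-2648/9) * c ^ 7 + (-3574/9) * c ^ 8 := by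
    rw [pow_succ, h5]
    rw [h1]
    linear_combination ((-144964/243) * c ^ 0 + (145889/243) * c ^ 1 + (-46961/243) * c ^ 2 + (21961/729) * c ^ 3 + (-6878/729) * c ^ 4 + (1855/729) * c ^ 5) * hc
  have h7 : ph c ^ 7 = (35087809/3) * c ^ 0 + (-4953235/3) * c ^ 1 + (-2291394) * c ^ 2 + (9748498/9) * c ^ 3 + (9653/9) * c ^ 4 + (335078/3) * c ^ 5 + (-5633969/27) * c ^ 6 + (2673581/27) * c ^ 7 + (-205409/9) * c ^ 8 := by
    rw [pow_succ, h6]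
    rw [h1]
    linear_combination ((1332788/243) * c ^ 0 + (-126490/81) * c ^ 1 + (-32746/243) * c ^ 2 + (95092/729) * c ^ 3 + (8074/243) * c ^ 4 + (-3574/243) * c ^ 5) * hc
  have h8 : ph c ^ 8 = (494193667/3) * c ^ 0 + (-96356960/3) * c ^ 1 + (178985788/3) * c ^ 2 + (-342614048/9) * c ^ 3 + (105337954/9) * c ^ 4 + (-27255944/9) * c ^ 5 + (15014632/27) * c ^ 6 + (12756718/27) * c ^ 7 + (-9962795/27) * c ^ 8 := by
    rw [pow_succ, h7]
    rw [h1]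
    linear_combination ((17652356/243) * c ^ 0 + (-2181149/243) * c ^ 1 + (6022976/243) * c ^ 2 + (-13654712/729) * c ^ 3 + (4522262/729) * c ^ 4 + (-205409/243) * c ^ 5) * hc
  have h9 : ph c ^ 9 = (-13930466597/3) * c ^ 0 + (1373215533) * c ^ 1 + (-368987343) * c ^ 2 + (-1218438719/9) * c ^ 3 + (187802924) * c ^ 4 + (-67334849) * c ^ 5 + (338994163/27) * c ^ 6 + (-23778940/3) * c ^ 7 + (17078725/3) * c ^ 8 := by
    rw [pow_succ, h8]
    rw [h1]
    linear_combination ((-515677969/243) * c ^ 0 + (169974119/243) * c ^ 1 + (-52233371/243) * c ^ 2 + (-23255522/729) * c ^ 3 + (42645103/729) * c ^ 4 + (-9962795/729) * c ^ 5) * hc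
  exact ⟨h2, h3, h4, h5, h6, h7, h8, h9⟩

lemma ph_root {c : Om} (hc : c ^ 9 = 2214) :
    ph c ^ 6 * (ph c - 1) ^ 3 + (3 : ℕ) * aeval (ph c) kk = 0 := by
  obtain ⟨h2, h3, h4, h5, h6, h7, h8, h9⟩ := ph_pow hc
  have h1 : ph c = (1/3) * c ^ 0 + (-1) * c ^ 1 + (1/3) * c ^ 2 + (1/9) * c ^ 3 + (-1/9) * c ^ 5 + (1/27) * c ^ 6 := rfl
  have e : ph c ^ 6 * (ph c - 1) ^ 3 + (3 : ℕ) * aeval (ph c) kk =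
     (1) * ph c ^ 9 + (-3) * ph c ^ 8 + (-78) * ph c ^ 7 + (-322) * ph c ^ 6 + (-27432) * ph c ^ 5 + (243828) * ph c ^ 4 + (4125684) * ph c ^ 3 + (-21470004) * ph c ^ 2 + (26086095) * ph c ^ 1 + (16669725) * ph c ^ 0 := by
    simp only [kk, map_add, map_mul, map_pow, aeval_X, aeval_C]
    simp only [eq_intCast]
    push_cast
    ring
  rw [e, h2, h3, h4, h5, h6, h7, h8, h9, pow_one, h1]
  ring


lemma AA_det : ¬ (3 : ℤ) ∣ AA.det := by
  intro h
  have h1 : (AA.map (Int.castRingHom (ZMod 3))) * AI = 1 := by decide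
  have h2 := congrArg Matrix.det h1
  rw [Matrix.det_mul, Matrix.det_one] at h2
  have h3 : (AA.map (Int.castRingHom (ZMod 3))).det = ((AA.det : ℤ) : ZMod 3) := by
    have := RingHom.map_det (Int.castRingHom (ZMod 3)) AA
    rw [eq_intCast] at this
    exact this.symm
  rw [h3, (ZMod.intCast_zmod_eq_zero_iff_dvd _ 3).2 (by exact_mod_cast h), zero_mul] at h2
  exact absurd h2 (by decide)

lemma EE_det : EE.det = 1 / 3 ^ 13 := by
  have h : EE.BlockTriangular OrderDual.toDual := by
    intro i j hij
    have hij : i < j := hij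
    revert hij
    fin_cases i <;> fin_cases j <;> simp [EE]
  rw [Matrix.det_of_lowerTriangular _ h]
  simp [Fin.prod_univ_succ, EE]
  norm_num

/-- Rational change of basis. -/
noncomputable def MM : Matrix (Fin 9) (Fin 9) ℚ := AA.map (Int.castRingHom ℚ) * EE

lemma MM_det : MM.det = (AA.det : ℚ) / 3 ^ 13 := by
  rw [MM, Matrix.det_mul, EE_det]
  have h3 : (AA.map (Int.castRingHom ℚ)).det = ((AA.det : ℤ) : ℚ) := by
    have := RingHom.map_det (Int.castRingHom ℚ) AA
    rw [eq_intCast] at this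
    exact this.symm
  rw [h3]; ring

lemma ph_row {c : Om} (hc : c ^ 9 = 2214) (m : Fin 9) :
    ph c ^ (m : ℕ) = ∑ k : Fin 9, (MM m k : Om) * c ^ (k : ℕ) := by
  obtain ⟨h2, h3, h4, h5, h6, h7, h8, h9⟩ := ph_pow hc
  have h1 : ph c = (1/3) * c ^ 0 + (-1) * c ^ 1 + (1/3) * c ^ 2 + (1/9) * c ^ 3 + (-1/9) * c ^ 5 + (1/27) * c ^ 6 := rfl
  have hM : ∀ k, (MM m k : Om) = ∑ j : Fin 9, (AA m j : Om) * (EE j k : Om) := by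
    intro k
    simp [MM, Matrix.mul_apply]
  simp only [hM]
  fin_cases m

  · simp [Fin.sum_univ_succ, AA, EE]
  · simp [Fin.sum_univ_succ, AA, EE]
    rw [h1]
    ring
  · simp [Fin.sum_univ_succ, AA, EE]
    rw [h2]
    ring
  · simp [Fin.sum_univ_succ, AA, EE]
    rw [h3]
    ring
  · simp [Fin.sum_univ_succ, AA, EE]
    rw [h4]
    ring
  · simp [Fin.sum_univ_succ, AA, EE]
    rw [h5]
    ring
  · simp [Fin.sum_univ_succ, AA, EE]
    rw [h6]
    ring
  · simp [Fin.sum_univ_succ, AA, EE]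
    rw [h7]
    ring
  · simp [Fin.sum_univ_succ, AA, EE]
    rw [h8]
    ring
end Ex17

namespace Ex17

lemma AA_det_ne : AA.det ≠ 0 := fun h => AA_det (by rw [h]; exact dvd_zero _)

lemma MM_unit : IsUnit MM.det := by
  rw [MM_det, isUnit_iff_ne_zero]
  exact div_ne_zero (by exact_mod_cast AA_det_ne) (by norm_num)

lemma exists_W : ∃ W : ℚ[X], ∀ c : Om, c ^ 9 = 2214 → c = aeval (ph c) W := by
  refine ⟨∑ m : Fin 9, C (MM⁻¹ 1 m) * X ^ (m : ℕ), ?_⟩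
  intro c hc
  simp only [map_sum, map_mul, map_pow, aeval_X, aeval_C]
  simp only [ph_row hc, Finset.mul_sum]
  rw [Finset.sum_comm]
  have h : ∀ k : Fin 9, ∑ m : Fin 9, (algebraMap ℚ Om (MM⁻¹ 1 m)) * ((MM m k : Om) * c ^ (k : ℕ)) =
      (((1 : Matrix (Fin 9) (Fin 9) ℚ) 1 k : ℚ) : Om) * c ^ (k : ℕ) := by
    intro k
    rw [← Matrix.nonsing_inv_mul MM MM_unit, Matrix.mul_apply]
    push_cast
    rw [Finset.sum_mul]
    exact Finset.sum_congr rfl (fun m _ => by rw [eq_ratCast]; ring)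
  simp only [h]
  rw [Finset.sum_eq_single (1 : Fin 9) (fun k _ hk => by rw [Matrix.one_apply_ne hk.symm]; simp) (by simp)]
  simp

lemma exists_Phi : ∃ P : ℚ[X], ∀ c : Om, ph c = aeval c P := by
  refine ⟨C (1/3) * X ^ 0 + C (-1) * X ^ 1 + C (1/3) * X ^ 2 + C (1/9) * X ^ 3 + C (-1/9) * X ^ 5 + C (1/27) * X ^ 6, ?_⟩
  intro c
  simp only [map_add, map_mul, map_pow, aeval_X, aeval_C]
  simp only [eq_ratCast]
  push_cast
  rfl

lemma ph_sigma (σ : Om ≃ₐ[ℚ] Om) (c : Om) : σ (ph c) = ph (σ c) := by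
  obtain ⟨P, hP⟩ := exists_Phi
  rw [hP, hP]; exact (aeval_algHom_apply σ c P).symm

lemma two_ne : (2214 : Om) ≠ 0 := by norm_num

/-- The conjugates of the ninth root. -/
noncomputable abbrev CC : Finset Om := rt 9 2214

lemma mem_CC {c : Om} : c ∈ CC ↔ c ^ 9 = 2214 := mem_rt (by norm_num)

lemma card_CC : CC.card = 9 := card_rt (by norm_num) two_ne

open Classical in
lemma reindex : ∃ v : Fin 9 → Om, (∀ i, v i ∈ CC) ∧ ∀ f : Om → Om → Om,
    ∏ d ∈ CC, ∏ c ∈ CC.erase d, f d c = ∏ i, ∏ j ∈ {i}ᶜ, f (v i) (v j) := by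
  let e := (Finset.equivFinOfCardEq card_CC).symm
  refine ⟨fun i => (e i : Om), fun i => (e i).2, ?_⟩
  intro f
  have hinj : Function.Injective (fun i => (e i : Om)) := fun i j h => e.injective (Subtype.ext h)
  have him : CC = Finset.univ.map ⟨_, hinj⟩ := by
    ext c
    simp only [Finset.mem_map, Finset.mem_univ, true_and, Function.Embedding.coeFn_mk]
    constructor
    · intro hc; exact ⟨e.symm ⟨c, hc⟩, by simp⟩
    · rintro ⟨i, rfl⟩; exact (e i).2
  have hmem : ∀ c, c ∈ CC ↔ ∃ j, (e j : Om) = c := fun c =>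
    ⟨fun hc => ⟨e.symm ⟨c, hc⟩, by simp⟩, by rintro ⟨i, rfl⟩; exact (e i).2⟩
  have h1 : ∀ i : Fin 9, CC.erase (e i : Om) = ({i}ᶜ : Finset (Fin 9)).map ⟨_, hinj⟩ := by
    intro i
    ext c
    rw [Finset.mem_erase]
    rw [hmem]
    simp only [Finset.mem_map, Function.Embedding.coeFn_mk,
      Finset.mem_compl, Finset.mem_singleton]
    constructor
    · rintro ⟨hne, j, rfl⟩
      exact ⟨j, fun h => hne (by rw [h]), rfl⟩
    · rintro ⟨j, hj, rfl⟩
      exact ⟨fun h => hj (hinj h), j, rfl⟩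
  have h2 : ∏ d ∈ CC, ∏ c ∈ CC.erase d, f d c
      = ∏ d ∈ Finset.univ.map ⟨_, hinj⟩, ∏ c ∈ CC.erase d, f d c := by
    exact Finset.prod_congr him (fun _ _ => rfl)
  rw [h2, Finset.prod_map]
  refine Finset.prod_congr rfl (fun i _ => ?_)
  simp only [Function.Embedding.coeFn_mk]
  rw [h1, Finset.prod_map]
  rfl

lemma offdiag_vdm (v : Fin 9 → Om) :
    ∏ i, ∏ j ∈ {i}ᶜ, (v i - v j) = (Matrix.vandermonde v).det ^ 2 * ∏ i : Fin 9, ∏ j ∈ Finset.Ioi i, (-1 : Om) := by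
  have h := Finset.prod_prod_Ioi_mul_eq_prod_prod_off_diag (fun j i : Fin 9 => v i - v j)
  rw [← h, Matrix.det_vandermonde, pow_two, ← Finset.prod_mul_distrib, ← Finset.prod_mul_distrib]
  refine Finset.prod_congr rfl (fun i _ => ?_)
  rw [← Finset.prod_mul_distrib, ← Finset.prod_mul_distrib]
  refine Finset.prod_congr rfl (fun j _ => ?_)
  ring

open Classical in
lemma disc_ph : (∏ d ∈ CC, ∏ c ∈ CC.erase d, (ph d - ph c)) * 3 ^ 26 =
    (AA.det : Om) ^ 2 * ∏ d ∈ CC, ∏ c ∈ CC.erase d, (d - c) := by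
  obtain ⟨v, hv, hf⟩ := reindex
  rw [hf (fun d c => ph d - ph c), hf (fun d c => d - c), offdiag_vdm (fun i => ph (v i)), offdiag_vdm v]
  have hV : Matrix.vandermonde (fun i => ph (v i)) =
      Matrix.vandermonde v * (MM.map (algebraMap ℚ Om)).transpose := by
    ext i m
    rw [Matrix.vandermonde_apply, ph_row (mem_CC.1 (hv i)), Matrix.mul_apply]
    refine Finset.sum_congr rfl (fun k _ => ?_)
    simp [Matrix.vandermonde_apply, mul_comm]
  have hd : (MM.map (algebraMap ℚ Om)).det = (AA.det : Om) / 3 ^ 13 := by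
    have := RingHom.map_det (algebraMap ℚ Om) MM
    rw [MM_det] at this
    have h2 : (MM.map (algebraMap ℚ Om)).det = algebraMap ℚ Om ((AA.det : ℚ) / 3 ^ 13) := this.symm
    rw [h2]; simp
  rw [hV, Matrix.det_mul, Matrix.det_transpose, hd]
  field_simp

lemma ph_inj {c d : Om} (hc : c ^ 9 = 2214) (hd : d ^ 9 = 2214) (h : ph c = ph d) : c = d := by
  obtain ⟨W, hW⟩ := exists_W
  rw [hW c hc, hW d hd, h]

/-- The monic polynomial of `ph`. -/
noncomputable def pp : ℤ[X] := X ^ 6 * (X - 1) ^ 3 + 3 * kk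

lemma pp_aux : pp.Monic ∧ pp.natDegree = 9 := by
  have h1 : ((X : ℤ[X]) ^ 6 * (X - C 1) ^ 3).Monic := (monic_X_pow 6).mul ((monic_X_sub_C 1).pow 3)
  have h2 : ((X : ℤ[X]) ^ 6 * (X - C 1) ^ 3).natDegree = 9 := by
    rw [(monic_X_pow 6).natDegree_mul ((monic_X_sub_C 1).pow 3), natDegree_X_pow,
      (monic_X_sub_C 1).natDegree_pow, natDegree_X_sub_C]
  have h3 : (3 * kk).degree < ((X : ℤ[X]) ^ 6 * (X - C 1) ^ 3).degree := by
    rw [degree_eq_natDegree h1.ne_zero, h2]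
    have : (3 * kk).degree ≤ 7 := by
      rw [kk]
      compute_degree
    exact lt_of_le_of_lt this (by norm_num)
  rw [C_1] at h1 h2 h3
  refine ⟨h1.add_of_left h3, ?_⟩
  rw [pp, natDegree_add_eq_left_of_degree_lt h3, h2]

lemma aeval_pp {c : Om} (hc : c ^ 9 = 2214) : aeval (ph c) pp = 0 := by
  rw [← ph_root hc, pp]
  simp only [map_add, map_mul, map_pow, map_sub, aeval_X, map_one, map_ofNat]
  push_cast
  rfl

lemma ph_integral {c : Om} (hc : c ^ 9 = 2214) : IsIntegral ℤ (ph c) :=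
  ⟨pp, pp_aux.1, by simpa [aeval_def] using aeval_pp hc⟩

lemma prod_ph : ∏ c ∈ CC, (X - C (ph c)) = pp.map (algebraMap ℤ Om) := by
  have hm : (pp.map (algebraMap ℤ Om)).Monic := pp_aux.1.map _
  have hnd : (CC.val.map ph).Nodup := by
    refine Multiset.Nodup.map_on ?_ CC.nodup
    intro c hc d hd h
    exact ph_inj (mem_CC.1 hc) (mem_CC.1 hd) h
  have e : ∏ c ∈ CC, (X - C (ph c)) = ((CC.val.map ph).map (fun a => X - C a)).prod := by
    rw [Multiset.map_map]; rfl
  have hdvd : ∏ c ∈ CC, (X - C (ph c)) ∣ pp.map (algebraMap ℤ Om) := by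
    rw [e, Multiset.prod_X_sub_C_dvd_iff_le_roots hm.ne_zero, Multiset.le_iff_subset hnd]
    intro x hx
    obtain ⟨c, hc, rfl⟩ := Multiset.mem_map.1 hx
    rw [mem_roots hm.ne_zero, IsRoot.def, eval_map_algebraMap]
    exact aeval_pp (mem_CC.1 hc)
  have hm' : (∏ c ∈ CC, (X - C (ph c))).Monic := monic_prod_of_monic _ _ (fun c _ => monic_X_sub_C _)
  refine (eq_of_monic_of_dvd_of_natDegree_le hm' hm hdvd ?_).symm
  rw [natDegree_prod_of_monic _ _ (fun i _ => monic_X_sub_C _), pp_aux.1.natDegree_map, pp_aux.2]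
  simp [card_CC]

lemma prod_ph_eval (n : ℤ) : ∏ c ∈ CC, (ph c - n) = - ((pp.eval n : ℤ) : Om) := by
  have h := congrArg (eval (n : Om)) prod_ph
  rw [eval_prod, eval_map_algebraMap] at h
  have e : (aeval (n : Om) pp : Om) = ((pp.eval n : ℤ) : Om) := by
    have := aeval_algebraMap_apply Om n pp
    simpa using this
  rw [e] at h
  rw [← h]
  have : ∀ c ∈ CC, ph c - (n : Om) = (-1) * eval (n : Om) (X - C (ph c)) := by
    intro c _; simp
  rw [Finset.prod_congr rfl this, Finset.prod_mul_distrib, Finset.prod_const, card_CC]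
  ring


lemma conjC {c d : Om} (hc : c ^ 9 = 2214) (hd : d ^ 9 = 2214) : ∃ σ : Om ≃ₐ[ℚ] Om, σ c = d :=
  conj_g (n := 9) (m := 2214) (by norm_num) (by norm_num) (by norm_num) (by rw [hc]; norm_num)
    (by rw [hd]; norm_num)

lemma not_int_aux {c : Om} (hc : c ^ 9 = 2214) (n : ℤ) (hn : (3 : ℤ) ∣ pp.eval n)
    (hk : ¬ (3 : ℤ) ∣ kk.eval n) (f : ℤ[X]) (hf : f * (X - C n) = X ^ 6 * (X - 1) ^ 3) :
    ¬ IsIntegral ℤ (aeval (ph c) f / ((3 : ℕ) : Om)) := by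
  intro hi
  obtain ⟨M, hM⟩ := exists_pr 3 Nat.prime_three
  have h1 : M (∏ d ∈ CC, (ph d - n)) := by
    rw [prod_ph_eval]
    obtain ⟨t, ht⟩ := hn
    rw [ht]
    have := hM.mul (-t) _ (isIntegral_int t).neg hM.q_mem
    convert this using 1; push_cast; ring
  have iphn : ∀ d ∈ CC, IsIntegral ℤ (ph d - n) := fun d hd =>
    (ph_integral (mem_CC.1 hd)).sub (isIntegral_int n)
  obtain ⟨d, hd, hdM⟩ := hM.of_prod Nat.prime_three CC iphn h1
  obtain ⟨σ, hσ⟩ := conjC hc (mem_CC.1 hd)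
  have hid : IsIntegral ℤ (aeval (ph d) f / ((3 : ℕ) : Om)) := by
    have e : aeval (ph d) f / ((3 : ℕ) : Om) = σ (aeval (ph c) f / ((3 : ℕ) : Om)) := by
      rw [map_div₀, map_natCast]
      congr 1
      have := aeval_algHom_apply (σ.toAlgHom.restrictScalars ℤ) (ph c) f
      have e2 : (σ.toAlgHom.restrictScalars ℤ) (ph c) = ph d := by
        rw [← hσ, ← ph_sigma]; rfl
      rw [e2] at this
      exact this
    rw [e]
    exact hi.map (σ.toAlgHom.restrictScalars ℤ)
  have h2 : aeval (ph d) kk = - (aeval (ph d) f / ((3 : ℕ) : Om)) * (ph d - n) := by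
    have h3 := ph_root (mem_CC.1 hd)
    have h4 := congrArg (aeval (ph d)) hf
    simp at h4
    have h5 : ((3 : ℕ) : Om) ≠ 0 := by norm_num
    field_simp
    push_cast at h3 ⊢
    linear_combination h3 + h4
  have h3 := hM.aeval_sub_eval (ph_integral (mem_CC.1 hd)) n hdM kk
  have h4 : M ((kk.eval n : ℤ) : Om) := by
    have e : ((kk.eval n : ℤ) : Om) = aeval (ph d) kk - (aeval (ph d) kk - ((kk.eval n : ℤ) : Om)) := by ring
    rw [e]
    refine hM.sub ?_ h3
    rw [h2]
    exact hM.mul _ _ hid.neg hdM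
  exact hk (by exact_mod_cast hM.dvd _ h4)

lemma Mx_ph {c : Om} (hc : c ^ 9 = 2214) : Mx 3 (ph c) := by
  have k0 : kk.eval 0 = 5556575 := by simp [kk]
  have k1 : ¬ (3 : ℤ) ∣ kk.eval 1 := by simp [kk]
  refine dedekind Nat.prime_three 6 3 kk (ph_integral hc) (ph_root hc) ?_ ?_
  · intro a' ha
    obtain rfl : a' = 5 := by omega
    have := not_int_aux hc 0 (by simp [pp]) (by rw [k0]; norm_num) (X ^ 5 * (X - 1) ^ 3) (by simp; ring)
    simpa using this
  · intro b' hb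
    obtain rfl : b' = 2 := by omega
    have := not_int_aux hc 1 (by simp [pp]) k1 (X ^ 6 * (X - 1) ^ 2) (by simp; ring)
    simpa using this
end Ex17

namespace Ex17

lemma aeval_sigma (σ : Om ≃ₐ[ℚ] Om) (x : Om) (P : ℚ[X]) : σ (aeval x P) = aeval (σ x) P :=
  (aeval_algHom_apply σ x P).symm

lemma aeval_sigmaZ (σ : Om ≃ₐ[ℚ] Om) (x : Om) (P : ℤ[X]) : σ (aeval x P) = aeval (σ x) P :=
  (aeval_algHom_apply (σ.toAlgHom.restrictScalars ℤ) x P).symm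

lemma int_sigma (σ : Om ≃ₐ[ℚ] Om) {x : Om} (h : IsIntegral ℤ x) : IsIntegral ℤ (σ x) :=
  h.map (σ.toAlgHom.restrictScalars ℤ)

lemma prod_rt_sigma {A : Type*} [CommMonoid A] {n : ℕ} (hn : 0 < n) (σ : Om ≃ₐ[ℚ] Om) (c : Om) (f : Om → A) :
    ∏ k ∈ rt n c, f (σ k) = ∏ k ∈ rt n (σ c), f k := by
  refine Finset.prod_nbij' σ σ.symm ?_ ?_ ?_ ?_ ?_
  · intro k hk
    rw [mem_rt hn] at hk ⊢
    rw [← map_pow, hk]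
  · intro k hk
    rw [mem_rt hn] at hk ⊢
    rw [← map_pow, hk]; simp
  · intro k _; simp
  · intro k _; simp
  · intro k _; rfl

lemma dv_of_roots (F : Finset Om) (θ : Om → Om) (hinj : ∀ k ∈ F, ∀ l ∈ F, θ k = θ l → k = l)
    (hIn : ∀ k ∈ F, IsIntegral ℤ (θ k)) (q : ℤ[X]) (v : Om) (hv : IsIntegral ℤ v)
    (h : ∀ k ∈ F, aeval (θ k) q = v) (t : Om) (ht : IsIntegral ℤ t) :
    Dv (∏ k ∈ F, (t - θ k)) (aeval t q - v) := by
  classical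
  let O := integralClosure ℤ Om
  let v' : O := ⟨v, hv⟩
  let t' : O := ⟨t, ht⟩
  let p : O[X] := q.map (algebraMap ℤ O) - C v'
  have hev : ∀ x : O, ((p.eval x : O) : Om) = aeval (x : Om) q - v := by
    intro x
    simp only [p, eval_sub, eval_C, eval_map_algebraMap]
    rw [← Polynomial.aeval_subalgebra_coe q (integralClosure ℤ Om) x]
    rfl
  have key : ∀ G : Finset Om, ∀ hG : G ⊆ F,
      ∏ k ∈ G.attach, (X - C (⟨θ k, hIn k (hG k.2)⟩ : O)) ∣ p := by
    intro G hG
    by_cases hp : p = 0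
    · rw [hp]; exact dvd_zero _
    have e : ∏ k ∈ G.attach, (X - C (⟨θ k, hIn k (hG k.2)⟩ : O)) =
        ((G.attach.val.map (fun k : G => (⟨θ k, hIn k (hG k.2)⟩ : O))).map (fun a => X - C a)).prod := by
      rw [Multiset.map_map]; rfl
    have hnd : (G.attach.val.map (fun k : G => (⟨θ k, hIn k (hG k.2)⟩ : O))).Nodup := by
      refine Multiset.Nodup.map_on ?_ G.attach.nodup
      intro k _ l _ hkl
      exact Subtype.ext (hinj k (hG k.2) l (hG l.2) (congrArg Subtype.val hkl))
    rw [e, Multiset.prod_X_sub_C_dvd_iff_le_roots hp, Multiset.le_iff_subset hnd]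
    intro x hx
    obtain ⟨k, _, rfl⟩ := Multiset.mem_map.1 hx
    rw [mem_roots hp, IsRoot.def]
    apply Subtype.ext
    rw [hev]
    change aeval (θ k) q - v = 0
    rw [h k (hG k.2), sub_self]
  obtain ⟨g, hg⟩ := key F (Finset.Subset.refl _)
  refine ⟨(g.eval t' : O), (g.eval t').2, ?_⟩
  have h1 := hev t'
  rw [hg, eval_mul, eval_prod] at h1
  have h2 : aeval t q - v = ((∏ k ∈ F.attach, eval t' (X - C (⟨θ k, hIn k k.2⟩ : O)) : O) : Om) * (g.eval t' : O) := by
    rw [← h1]; rfl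
  rw [h2]
  congr 1
  rw [← Finset.prod_attach F]
  rw [← Subalgebra.coe_val, map_prod]
  refine Finset.prod_congr rfl (fun k _ => ?_)
  simp [t']

/-- All conjugates. -/
noncomputable def SS : Finset Om := rt 135 2214

lemma mem_SS {s : Om} : s ∈ SS ↔ s ^ 135 = 2214 := mem_rt (by norm_num)

lemma card_SS : SS.card = 135 := card_rt (by norm_num) two_ne

lemma pow_mem {s : Om} (h : s ∈ SS) : s ^ 15 ∈ CC := by
  rw [mem_CC, ← pow_mul]; exact mem_SS.1 h

lemma mem_of_cluster {c s : Om} (hc : c ∈ CC) (h : s ∈ rt 15 c) : s ∈ SS := by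
  rw [mem_rt (by norm_num)] at h
  rw [mem_CC, ← h, ← pow_mul] at hc
  exact mem_SS.2 hc

lemma CC_ne {c : Om} (hc : c ∈ CC) : c ≠ 0 := by
  rintro rfl
  rw [mem_CC, zero_pow (by norm_num)] at hc
  exact two_ne hc.symm

lemma sigma_SS (σ : Om ≃ₐ[ℚ] Om) {s : Om} (h : s ∈ SS) : σ s ∈ SS := by
  rw [mem_SS] at h ⊢
  rw [← map_pow, h]; exact map_ofNat σ 2214

lemma sigma_CC (σ : Om ≃ₐ[ℚ] Om) {s : Om} (h : s ∈ CC) : σ s ∈ CC := by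
  rw [mem_CC] at h ⊢
  rw [← map_pow, h]; exact map_ofNat σ 2214

lemma exists_root {c : Om} (hc : c ∈ CC) : ∃ s ∈ SS, s ^ 15 = c := by
  have h : (rt 15 c).card = 15 := card_rt (by norm_num) (CC_ne hc)
  have : (rt 15 c).Nonempty := by rw [← Finset.card_pos, h]; norm_num
  obtain ⟨s, hs⟩ := this
  exact ⟨s, mem_of_cluster hc hs, (mem_rt (by norm_num)).1 hs⟩

open Classical in
lemma group_prod (g : Om → Om) : ∏ i ∈ SS, g (i ^ 15) = ∏ d ∈ CC, (g d) ^ 15 := by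
  rw [← Finset.prod_fiberwise_of_maps_to (g := fun i : Om => i ^ 15) (t := CC) (fun i hi => pow_mem hi)]
  refine Finset.prod_congr rfl (fun d hd => ?_)
  have e : SS.filter (fun i => i ^ 15 = d) = rt 15 d := by
    ext s
    rw [Finset.mem_filter]
    constructor
    · rintro ⟨_, h⟩; exact (mem_rt (by norm_num)).2 h
    · intro h; exact ⟨mem_of_cluster hd h, (mem_rt (by norm_num)).1 h⟩
  rw [e]
  have : ∀ i ∈ rt 15 d, g (i ^ 15) = g d := by
    intro i hi; rw [(mem_rt (by norm_num)).1 hi]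
  rw [Finset.prod_congr rfl this, Finset.prod_const, card_rt (by norm_num) (CC_ne hd)]

open Classical in
/-- The double product over a root and a foreign cluster. -/
noncomputable def PP (f : Om → Om → Om) : Om := ∏ i ∈ SS, ∏ c ∈ CC.erase (i ^ 15), f i c

open Classical in
lemma PP_fixed (f : Om → Om → Om)
    (hf : ∀ σ : Om ≃ₐ[ℚ] Om, ∀ i ∈ SS, ∀ c ∈ CC, σ (f i c) = f (σ i) (σ c)) (σ : Om ≃ₐ[ℚ] Om) :
    σ (PP f) = PP f := by
  have h2214 : σ 2214 = 2214 := map_ofNat σ 2214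
  rw [PP, map_prod]
  have h1 : ∀ i ∈ SS, σ (∏ c ∈ CC.erase (i ^ 15), f i c) = ∏ c ∈ CC.erase ((σ i) ^ 15), f (σ i) c := by
    intro i hi
    rw [map_prod]
    refine Finset.prod_nbij' σ σ.symm ?_ ?_ ?_ ?_ ?_
    · intro c hc
      rw [Finset.mem_erase] at hc ⊢
      refine ⟨fun h => hc.1 ?_, sigma_CC σ hc.2⟩
      rw [← map_pow] at h
      exact σ.injective h
    · intro c hc
      rw [Finset.mem_erase] at hc ⊢
      refine ⟨fun h => hc.1 ?_, sigma_CC σ.symm hc.2⟩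
      rw [← map_pow, ← h]; simp
    · intro k _; simp
    · intro k _; simp
    · intro c hc; exact hf σ i hi c (Finset.mem_of_mem_erase hc)
  rw [Finset.prod_congr rfl h1]
  have := prod_rt_sigma (n := 135) (by norm_num) σ 2214 (fun i => ∏ c ∈ CC.erase (i ^ 15), f i c)
  rw [h2214] at this
  exact this

open Classical in
lemma PP_int (f : Om → Om → Om) (hi : ∀ i ∈ SS, ∀ c ∈ CC, IsIntegral ℤ (f i c)) : IsIntegral ℤ (PP f) :=
  IsIntegral.prod _ (fun i h => IsIntegral.prod _ (fun c hc => hi i h c (Finset.mem_of_mem_erase hc)))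

open Classical in
lemma PP_Dv (f g : Om → Om → Om) (h : ∀ i ∈ SS, ∀ c ∈ CC, Dv (f i c) (g i c)) : Dv (PP f) (PP g) :=
  Dv.prod _ (fun i hi => Dv.prod _ (fun c hc => h i hi c (Finset.mem_of_mem_erase hc)))

open Classical in
lemma PP_ne (f : Om → Om → Om) (h : ∀ i ∈ SS, ∀ c ∈ CC, c ≠ i ^ 15 → f i c ≠ 0) : PP f ≠ 0 := by
  rw [PP, Finset.prod_ne_zero_iff]
  intro i hi
  rw [Finset.prod_ne_zero_iff]
  intro c hc
  rw [Finset.mem_erase] at hc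
  exact h i hi c hc.2 hc.1

open Classical in
lemma PP_const_mul (n : Om) (f : Om → Om → Om) : PP (fun i c => n * f i c) = n ^ 1080 * PP f := by
  rw [PP]
  have : ∀ i ∈ SS, ∏ c ∈ CC.erase (i ^ 15), n * f i c = n ^ 8 * ∏ c ∈ CC.erase (i ^ 15), f i c := by
    intro i hi
    rw [Finset.prod_mul_distrib, Finset.prod_const, Finset.card_erase_of_mem (pow_mem hi), card_CC]
  rw [Finset.prod_congr rfl this, Finset.prod_mul_distrib, Finset.prod_const, card_SS, ← pow_mul]
  rfl

open Classical in
lemma der_CC {d : Om} (hd : d ∈ CC) : ∏ c ∈ CC.erase d, (d - c) = 9 * d ^ 8 := by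
  have h := prod_rt (n := 9) (by norm_num) two_ne
  change ∏ s ∈ CC, _ = _ at h
  rw [← Finset.mul_prod_erase _ _ hd] at h
  have h2 := congrArg (fun p => eval d (derivative p)) h
  simp only [derivative_mul, derivative_sub, derivative_X, derivative_C, derivative_X_pow, eval_add, eval_mul,
    eval_sub, eval_X, eval_C, eval_prod] at h2
  simpa using h2

lemma prod_CC : ∏ d ∈ CC, d = 2214 := by
  have h := prod_sub_rt (n := 9) (by norm_num) two_ne 0
  change ∏ s ∈ CC, _ = _ at h
  have e : ∀ s ∈ CC, (0 - s) = (-1) * s := by intro s _; ring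
  rw [Finset.prod_congr rfl e, Finset.prod_mul_distrib, Finset.prod_const, card_CC] at h
  linear_combination -h

open Classical in
lemma PP_group (x : Om → Om) : PP (fun i c => x (i ^ 15) - x c) =
    (∏ d ∈ CC, ∏ c ∈ CC.erase d, (x d - x c)) ^ 15 := by
  rw [PP, group_prod (fun d => ∏ c ∈ CC.erase d, (x d - x c)), Finset.prod_pow]

lemma PP_gamma : PP (fun i c => i ^ 15 - c) = 9 ^ 135 * 2214 ^ 120 := by
  classical
  rw [PP_group (fun c => c)]
  rw [Finset.prod_congr rfl (fun d hd => der_CC hd), Finset.prod_mul_distrib, Finset.prod_const,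
    Finset.prod_pow, prod_CC, card_CC, mul_pow, ← pow_mul, ← pow_mul]

lemma PP_ph : PP (fun i c => ph (i ^ 15) - ph c) * 3 ^ 390 = (AA.det : Om) ^ 30 * PP (fun i c => i ^ 15 - c) := by
  classical
  rw [PP_group (fun c => c), PP_group ph]
  have := congrArg (fun z => z ^ 15) disc_ph
  simp only [mul_pow, ← pow_mul] at this
  exact this
end Ex17

namespace Ex17

/-- The value at a cluster. -/
noncomputable def GG (T : ℚ[X]) (i c : Om) : Om := ∏ k ∈ rt 15 c, (aeval i T - aeval k T)

lemma GG_sigma (T : ℚ[X]) (σ : Om ≃ₐ[ℚ] Om) (i c : Om) : σ (GG T i c) = GG T (σ i) (σ c) := by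
  rw [GG, GG, ← prod_rt_sigma (by norm_num) σ c, map_prod]
  refine Finset.prod_congr rfl (fun k _ => ?_)
  rw [map_sub, aeval_sigma, aeval_sigma]

lemma th_int {T : ℚ[X]} {a : Om} (ha : a ∈ SS) (hT : IsIntegral ℤ (aeval a T)) {s : Om} (hs : s ∈ SS) :
    IsIntegral ℤ (aeval s T) := by
  obtain ⟨σ, rfl⟩ := conj (mem_SS.1 ha) (mem_SS.1 hs)
  rw [← aeval_sigma]
  exact int_sigma σ hT

lemma GG_int {T : ℚ[X]} (hT : ∀ s ∈ SS, IsIntegral ℤ (aeval s T)) {i c : Om} (hi : i ∈ SS) (hc : c ∈ CC) :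
    IsIntegral ℤ (GG T i c) :=
  IsIntegral.prod _ (fun k hk => (hT i hi).sub (hT k (mem_of_cluster hc hk)))

lemma claimA {T : ℚ[X]} {a : Om} (ha : a ∈ SS) (hT : ∀ s ∈ SS, IsIntegral ℤ (aeval s T))
    (hinj : ∀ k ∈ SS, ∀ l ∈ SS, aeval k T = aeval l T → k = l)
    (hmono : ∀ P : ℚ[X], IsIntegral ℤ (aeval a P) →
      ∃ q : ℤ[X], ∀ s ∈ SS, aeval s P = aeval (aeval s T) q)
    (P : ℚ[X]) (hP : ∀ c ∈ CC, IsIntegral ℤ (aeval c P)) {i c : Om} (hi : i ∈ SS) (hc : c ∈ CC) :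
    Dv (GG T i c) (aeval (i ^ 15) P - aeval c P) := by
  have e : ∀ s : Om, aeval s (P.comp (X ^ 15)) = aeval (s ^ 15) P := by
    intro s; rw [aeval_comp]; simp
  obtain ⟨q, hq⟩ := hmono (P.comp (X ^ 15)) (by rw [e]; exact hP _ (pow_mem ha))
  have h1 := dv_of_roots (rt 15 c) (fun k => aeval k T)
    (fun k hk l hl h => hinj k (mem_of_cluster hc hk) l (mem_of_cluster hc hl) h)
    (fun k hk => hT k (mem_of_cluster hc hk)) q (aeval c P) (hP c hc)
    (fun k hk => by
      rw [← hq k (mem_of_cluster hc hk), e, (mem_rt (by norm_num)).1 hk]) (aeval i T) (hT i hi)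
  rw [← hq i hi, e] at h1
  exact h1

/-- The cluster polynomial. -/
noncomputable def CP (T : ℚ[X]) (c : Om) : Om[X] := ∏ k ∈ rt 15 c, (X - C (aeval k T))

lemma CP_sigma (T : ℚ[X]) (σ : Om ≃ₐ[ℚ] Om) (c : Om) : (CP T c).map (σ : Om →+* Om) = CP T (σ c) := by
  rw [CP, CP, ← prod_rt_sigma (by norm_num) σ c, Polynomial.map_prod]
  refine Finset.prod_congr rfl (fun k _ => ?_)
  rw [Polynomial.map_sub, map_X, map_C, ← aeval_sigma]
  rfl

lemma CP_coeff_sigma (T : ℚ[X]) (σ : Om ≃ₐ[ℚ] Om) (c : Om) (m : ℕ) :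
    σ ((CP T c).coeff m) = (CP T (σ c)).coeff m := by
  rw [← CP_sigma, coeff_map]; rfl

lemma CP_coeff (T : ℚ[X]) {c₀ : Om} (hc₀ : c₀ ∈ CC) (m : ℕ) :
    ∃ P : ℚ[X], ∀ c ∈ CC, (CP T c).coeff m = aeval c P := by
  have h1 : (CP T c₀).coeff m ∈ IntermediateField.fixedField (IntermediateField.adjoin ℚ {c₀}).fixingSubgroup := by
    rw [IntermediateField.mem_fixedField_iff]
    intro σ hσ
    rw [IntermediateField.mem_fixingSubgroup_iff] at hσ
    have := hσ c₀ (IntermediateField.mem_adjoin_simple_self ℚ c₀)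
    rw [CP_coeff_sigma, this]
  rw [InfiniteGalois.fixedField_fixingSubgroup, ← IntermediateField.mem_toSubalgebra,
    IntermediateField.adjoin_simple_toSubalgebra_of_isAlgebraic (Algebra.IsAlgebraic.isAlgebraic c₀),
    Algebra.adjoin_singleton_eq_range_aeval] at h1
  obtain ⟨P, hP⟩ := h1
  refine ⟨P, fun c hc => ?_⟩
  obtain ⟨σ, rfl⟩ := conjC (mem_CC.1 hc₀) (mem_CC.1 hc)
  rw [← CP_coeff_sigma, ← aeval_sigma]
  exact congrArg σ hP.symm

lemma CP_coeff_int {T : ℚ[X]} (hT : ∀ s ∈ SS, IsIntegral ℤ (aeval s T)) {c : Om} (hc : c ∈ CC) (m : ℕ) :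
    IsIntegral ℤ ((CP T c).coeff m) := by
  let O := integralClosure ℤ Om
  have : CP T c = (∏ k ∈ (rt 15 c).attach, (X - C (⟨aeval k.1 T, hT k (mem_of_cluster hc k.2)⟩ : O))).map
      (algebraMap O Om) := by
    rw [Polynomial.map_prod, CP, ← Finset.prod_attach]
    refine Finset.prod_congr rfl (fun k _ => ?_)
    rw [Polynomial.map_sub, map_X, map_C]
    rfl
  rw [this, coeff_map]
  exact ((∏ k ∈ (rt 15 c).attach, (X - C (⟨aeval k.1 T, hT k (mem_of_cluster hc k.2)⟩ : O))).coeff m).2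

lemma CP_deg (T : ℚ[X]) {c : Om} (hc : c ∈ CC) : (CP T c).natDegree < 16 := by
  rw [CP, natDegree_prod_of_monic _ _ (fun i _ => monic_X_sub_C _)]
  simp [card_rt (n := 15) (by norm_num) (CC_ne hc)]

lemma GG_eq (T : ℚ[X]) {i c : Om} (hi : i ∈ SS) (hc : c ∈ CC) :
    GG T i c = ∑ m ∈ Finset.range 16, ((CP T c).coeff m - (CP T (i ^ 15)).coeff m) * (aeval i T) ^ m := by
  have h1 : eval (aeval i T) (CP T c) = GG T i c := by
    rw [CP, GG, eval_prod]; simp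
  have h2 : eval (aeval i T) (CP T (i ^ 15)) = 0 := by
    rw [CP, eval_prod]
    exact Finset.prod_eq_zero ((mem_rt (by norm_num)).2 rfl : i ∈ rt 15 (i ^ 15)) (by simp)
  rw [eval_eq_sum_range' (CP_deg T hc)] at h1
  rw [eval_eq_sum_range' (CP_deg T (pow_mem hi))] at h2
  simp only [sub_mul, Finset.sum_sub_distrib]
  rw [h1, h2, sub_zero]

lemma claimB {T : ℚ[X]} (hT : ∀ s ∈ SS, IsIntegral ℤ (aeval s T)) {q : ℕ} (hq : q.Prime) (x : Om → Om)
    (hx : ∀ c ∈ CC, IsIntegral ℤ (x c)) (hxs : ∀ (σ : Om ≃ₐ[ℚ] Om) (c : Om), σ (x c) = x (σ c))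
    {c₀ : Om} (hc₀ : c₀ ∈ CC) (hM : Mx q (x c₀)) (W : ℚ[X]) (hW : ∀ c ∈ CC, c = aeval (x c) W) :
    ∃ n : ℤ, ¬ (q : ℤ) ∣ n ∧ ∀ i ∈ SS, ∀ c ∈ CC, Dv (x (i ^ 15) - x c) (n * GG T i c) := by
  have step : ∀ m : ℕ, ∃ n : ℤ, ¬ (q : ℤ) ∣ n ∧ ∃ s : ℤ[X], ∀ c ∈ CC, n * (CP T c).coeff m = aeval (x c) s := by
    intro m
    obtain ⟨P, hP⟩ := CP_coeff T hc₀ m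
    obtain ⟨n, hn, s, hs⟩ := denom hq hM (CP_coeff_int hT hc₀ m) (P.comp W)
      (by rw [aeval_comp, ← hW c₀ hc₀]; exact hP c₀ hc₀)
    refine ⟨n, hn, s, fun c hc => ?_⟩
    obtain ⟨σ, rfl⟩ := conjC (mem_CC.1 hc₀) (mem_CC.1 hc)
    have := congrArg σ hs
    rw [map_mul, map_intCast, CP_coeff_sigma, aeval_sigmaZ, hxs] at this
    exact this
  choose n hn s hs using step
  have hqp : Prime (q : ℤ) := Nat.prime_iff_prime_int.1 hq
  refine ⟨∏ m ∈ Finset.range 16, n m, ?_, ?_⟩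
  · intro h
    obtain ⟨m, _, hm⟩ := hqp.exists_mem_finset_dvd h
    exact hn m hm
  · intro i hi c hc
    rw [GG_eq T hi hc, Finset.mul_sum]
    refine Dv.sum _ (fun m hm => ?_)
    have h1 := Dv.aeval_sub (hx _ (pow_mem hi)) (hx c hc) (s m)
    rw [← hs m _ (pow_mem hi), ← hs m c hc] at h1
    have h2 := h1.mul_right (t := - (((∏ l ∈ (Finset.range 16).erase m, n l : ℤ) : Om) * (aeval i T) ^ m))
      (((isIntegral_int _).mul ((hT i hi).pow m)).neg)
    convert h2 using 1
    rw [← Finset.mul_prod_erase _ _ hm]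
    push_cast
    ring

lemma local41 {T : ℚ[X]} {a : Om} (ha : a ∈ SS) (hT : ∀ s ∈ SS, IsIntegral ℤ (aeval s T))
    (hne : PP (GG T) ≠ 0) (Qt : ℤ) (hQ : PP (fun i c => i ^ 15 - c) = PP (GG T) * Qt) :
    (41 : ℤ) ∣ Qt - 1 := by
  classical
  have h41 : Nat.Prime 41 := by norm_num
  obtain ⟨D, hD, t, ht⟩ := denom (q := 41) h41
    (eis (q := 41) (n := 135) h41 (by norm_num) 54 (by norm_num) (by norm_num) (mem_SS.1 ha)) (hT a ha) T rfl
  have ht' : ∀ s ∈ SS, D * aeval s T = aeval s t := by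
    intro s hs
    obtain ⟨σ, rfl⟩ := conj (mem_SS.1 ha) (mem_SS.1 hs)
    have := congrArg σ ht
    rw [map_mul, map_intCast, aeval_sigma, aeval_sigmaZ] at this
    exact this
  obtain ⟨M, hM⟩ := exists_pr 41 h41
  have hsM : ∀ s ∈ SS, M s := by
    intro s hs
    have hs' := mem_SS.1 hs
    refine hM.of_pow h41 (integral_S (n := 135) (by norm_num) hs') (n := 135) ?_
    rw [hs']
    have := hM.mul ((54 : ℤ) : Om) _ (isIntegral_int 54) hM.q_mem
    convert this using 1
    norm_num
  have hr : ∀ i k : Om, ∃ r : Om, i ∈ SS → k ∈ SS →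
      (IsIntegral ℤ r ∧ D * (aeval i T - aeval k T) = (i - k) * r ∧ M (r - (t.coeff 1 : ℤ))) := by
    intro i k
    by_cases hi : i ∈ SS
    · by_cases hk : k ∈ SS
      · obtain ⟨r, h1, h2, h3⟩ := hM.taylor (hsM i hi) (hsM k hk) t
        refine ⟨r, fun _ _ => ⟨h1, ?_, h3⟩⟩
        rw [← h2, mul_sub, ht' i hi, ht' k hk]
      · exact ⟨0, fun _ h => absurd h hk⟩
    · exact ⟨0, fun h => absurd h hi⟩
  choose r hr using hr
  let Rf : Om → Om → Om := fun i c => ∏ k ∈ rt 15 c, r i k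
  have hRint : ∀ i ∈ SS, ∀ c ∈ CC, IsIntegral ℤ (Rf i c) := fun i hi c hc =>
    IsIntegral.prod _ (fun k hk => (hr i k hi (mem_of_cluster hc hk)).1)
  have hfac : ∀ i ∈ SS, ∀ c ∈ CC, (D : Om) ^ 15 * GG T i c = (i ^ 15 - c) * Rf i c := by
    intro i hi c hc
    rw [← prod_sub_rt (n := 15) (by norm_num) (CC_ne hc) i, ← Finset.prod_mul_distrib, GG]
    have : (D : Om) ^ 15 = ∏ k ∈ rt 15 c, (D : Om) := by
      rw [Finset.prod_const, card_rt (by norm_num) (CC_ne hc)]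
    rw [this, ← Finset.prod_mul_distrib]
    exact Finset.prod_congr rfl (fun k hk => (hr i k hi (mem_of_cluster hc hk)).2.1)
  have hP1 : PP (fun i c => (D : Om) ^ 15 * GG T i c) = PP (fun i c => i ^ 15 - c) * PP Rf := by
    rw [PP, PP, PP, ← Finset.prod_mul_distrib]
    refine Finset.prod_congr rfl (fun i hi => ?_)
    rw [← Finset.prod_mul_distrib]
    exact Finset.prod_congr rfl (fun c hc => hfac i hi c (Finset.mem_of_mem_erase hc))
  rw [PP_const_mul, hQ, ← pow_mul] at hP1
  have hP2 : (D : Om) ^ (15 * 1080) = Qt * PP Rf := by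
    apply mul_right_cancel₀ hne
    rw [hP1]; ring
  have hRM : M (PP Rf - PP (fun i c => ((t.coeff 1 : ℤ) : Om) ^ 15 * 1)) := by
    refine hM.prod_sub _ ?_ ?_ ?_
    · intro i hi
      exact IsIntegral.prod _ (fun c hc => hRint i hi c (Finset.mem_of_mem_erase hc))
    · intro i hi
      exact IsIntegral.prod _ (fun c hc => ((isIntegral_int _).pow _).mul isIntegral_one)
    · intro i hi
      refine hM.prod_sub _ ?_ ?_ ?_
      · intro c hc; exact hRint i hi c (Finset.mem_of_mem_erase hc)
      · intro c hc; exact ((isIntegral_int _).pow _).mul isIntegral_one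
      · intro c hc
        have hc' := Finset.mem_of_mem_erase hc
        have e : ((t.coeff 1 : ℤ) : Om) ^ 15 * 1 = ∏ k ∈ rt 15 c, ((t.coeff 1 : ℤ) : Om) := by
          rw [Finset.prod_const, card_rt (by norm_num) (CC_ne hc'), mul_one]
        rw [e]
        exact hM.prod_sub _ (fun k hk => (hr i k hi (mem_of_cluster hc' hk)).1) (fun k _ => isIntegral_int _)
          (fun k hk => (hr i k hi (mem_of_cluster hc' hk)).2.2)
  have hone : PP (fun _ _ => 1) = 1 := by simp [PP]
  rw [PP_const_mul, hone, mul_one, ← pow_mul] at hRM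
  have hfin : M ((D ^ (15 * 1080) - Qt * (t.coeff 1) ^ (15 * 1080) : ℤ) : Om) := by
    have := hM.mul (Qt : Om) _ (isIntegral_int Qt) hRM
    rw [mul_sub, ← hP2] at this
    rw [Int.cast_sub, Int.cast_mul, Int.cast_pow, Int.cast_pow]
    exact this
  have hdv := hM.dvd _ hfin
  have : Fact (Nat.Prime 41) := ⟨h41⟩
  have e1 : ((D : ZMod 41)) ^ (15 * 1080) - Qt * ((t.coeff 1 : ℤ) : ZMod 41) ^ (15 * 1080) = 0 := by
    have := (ZMod.intCast_zmod_eq_zero_iff_dvd _ 41).2 hdv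
    rw [Int.cast_sub, Int.cast_mul, Int.cast_pow, Int.cast_pow] at this
    exact this
  have fl : ∀ z : ZMod 41, z ≠ 0 → z ^ (15 * 1080) = 1 := by
    intro z hz
    have h40 : z ^ 40 = 1 := ZMod.pow_card_sub_one_eq_one hz
    have : 15 * 1080 = 40 * 405 := by norm_num
    rw [this, pow_mul, h40, one_pow]
  have hD0 : (D : ZMod 41) ≠ 0 := fun h => hD ((ZMod.intCast_zmod_eq_zero_iff_dvd _ 41).1 h)
  rw [fl _ hD0] at e1
  have ht0 : ((t.coeff 1 : ℤ) : ZMod 41) ≠ 0 := by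
    intro h
    rw [h, zero_pow (by norm_num), mul_zero, sub_zero] at e1
    exact one_ne_zero e1
  rw [fl _ ht0, mul_one] at e1
  have e2 : ((Qt - 1 : ℤ) : ZMod 41) = 0 := by
    rw [Int.cast_sub, Int.cast_one]
    linear_combination -e1
  exact (ZMod.intCast_zmod_eq_zero_iff_dvd _ 41).1 e2

end Ex17

namespace Ex17

lemma to_int {f : Om → Om → Om} (hi : ∀ i ∈ SS, ∀ c ∈ CC, IsIntegral ℤ (f i c))
    (hf : ∀ σ : Om ≃ₐ[ℚ] Om, ∀ i ∈ SS, ∀ c ∈ CC, σ (f i c) = f (σ i) (σ c)) : ∃ n : ℤ, PP f = n :=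
  int_of_fixed (PP_int f hi) (PP_fixed f hf)

lemma arith {H G F Qt Qf d n2 n41 n3 : ℤ} (hH : H ≠ 0) (hG : G = 9 ^ 135 * 2214 ^ 120) (h1 : G = H * Qt)
    (h2 : F = H * Qf) (h3 : G ∣ n2 * H) (h4 : G ∣ n41 * H) (h5 : F ∣ n3 * H)
    (hn2 : ¬ (2 : ℤ) ∣ n2) (hn41 : ¬ (41 : ℤ) ∣ n41) (hn3 : ¬ (3 : ℤ) ∣ n3)
    (hd : ¬ (3 : ℤ) ∣ d) (hF : F * 3 ^ 390 = d ^ 30 * G) (hQ : (41 : ℤ) ∣ Qt - 1) : False := by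
  have p3 : Prime (3 : ℤ) := Int.prime_three
  have q2 : Qt ∣ n2 := by
    rw [h1, mul_comm n2] at h3
    exact (mul_dvd_mul_iff_left hH).1 h3
  have q41 : Qt ∣ n41 := by
    rw [h1, mul_comm n41] at h4
    exact (mul_dvd_mul_iff_left hH).1 h4
  have q3 : Qf ∣ n3 := by
    rw [h2, mul_comm n3] at h5
    exact (mul_dvd_mul_iff_left hH).1 h5
  have hrel : Qf * 3 ^ 390 = d ^ 30 * Qt := by
    apply mul_left_cancel₀ hH
    rw [h1, h2] at hF
    linear_combination hF
  have hcop : IsCoprime ((3 : ℤ) ^ 390) (d ^ 30) :=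
    IsCoprime.pow ((Prime.coprime_iff_not_dvd p3).2 hd)
  have h390 : (3 : ℤ) ^ 390 ∣ Qt :=
    hcop.dvd_of_dvd_mul_left (Dvd.intro_left _ hrel)
  obtain ⟨w, hw⟩ := h390
  have hQf : Qf = d ^ 30 * w := by
    have h0 : (3 : ℤ) ^ 390 ≠ 0 := pow_ne_zero _ (by norm_num)
    apply mul_right_cancel₀ h0
    rw [hrel, hw]; ring
  have w2 : ¬ (2 : ℤ) ∣ w := fun h => hn2 ((h.trans (hw ▸ Dvd.intro_left _ rfl)).trans q2)
  have w41 : ¬ (41 : ℤ) ∣ w := fun h => hn41 ((h.trans (hw ▸ Dvd.intro_left _ rfl)).trans q41)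
  have w3 : ¬ (3 : ℤ) ∣ w := fun h => hn3 ((h.trans (hQf ▸ Dvd.intro_left _ rfl)).trans q3)
  have wG : w ∣ G := by
    rw [h1, hw]; exact ⟨H * 3 ^ 390, by ring⟩
  have hunit : IsUnit w := by
    by_contra hu
    obtain ⟨p, hp, hpw⟩ := Int.exists_prime_and_dvd (fun h => hu (Int.isUnit_iff_natAbs_eq.2 h))
    have hpG := hpw.trans wG
    rw [hG] at hpG
    have e9 : (9 : ℤ) = 3 * 3 := by norm_num
    have e22 : (2214 : ℤ) = 2 * (3 * 3 * 3) * 41 := by norm_num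
    have as : ∀ r : ℤ, Prime r → p ∣ r → r ∣ w := fun r hr h => ((hp.associated_of_dvd hr h).symm.dvd).trans hpw
    have hfin : p ∣ 2 ∨ p ∣ 3 ∨ p ∣ 41 := by
      rcases hp.dvd_or_dvd hpG with h | h
      · have := hp.dvd_of_dvd_pow h
        rw [e9] at this
        rcases hp.dvd_or_dvd this with h | h <;> tauto
      · have := hp.dvd_of_dvd_pow h
        rw [e22] at this
        simp only [hp.dvd_mul] at this
        tauto
    rcases hfin with h | h | h
    · exact w2 (as 2 Int.prime_two h)
    · exact w3 (as 3 p3 h)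
    · exact w41 (as 41 (by norm_num) h)
  have key : (41 : ℤ) ∣ 3 ^ 390 + 9 := by
    have : (3 : ℤ) ^ 390 + 9 = ((3 ^ 8) ^ 48 - 1) * 3 ^ 6 + (3 ^ 6 + 9) := by
      have e : (3 : ℤ) ^ 390 = (3 ^ 8) ^ 48 * 3 ^ 6 := by rw [← pow_mul, ← pow_add]
      rw [e]; generalize ((3 : ℤ) ^ 8) ^ 48 = Y; ring
    rw [this]
    refine dvd_add (Dvd.dvd.mul_right ?_ _) (by norm_num)
    have h8 : (41 : ℤ) ∣ 3 ^ 8 - 1 := by norm_num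
    exact h8.trans (by simpa using sub_dvd_pow_sub_pow ((3 : ℤ) ^ 8) 1 48)
  rw [hw] at hQ
  generalize (3 : ℤ) ^ 390 = Z at *
  rcases Int.isUnit_iff.1 hunit with h | h
  · rw [h] at hQ; omega
  · rw [h] at hQ; omega

theorem core {a : Om} (ha : a ^ 135 = 2214) (T : ℚ[X]) (hT : IsIntegral ℤ (aeval a T))
    (hmono : ∀ P : ℚ[X], IsIntegral ℤ (aeval a P) → ∃ q : ℤ[X], aeval a P = aeval (aeval a T) q) : False := by
  have haS : a ∈ SS := mem_SS.2 ha
  have hTS : ∀ s ∈ SS, IsIntegral ℤ (aeval s T) := fun s hs => th_int haS hT hs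
  have hmono' : ∀ P : ℚ[X], IsIntegral ℤ (aeval a P) →
      ∃ q : ℤ[X], ∀ s ∈ SS, aeval s P = aeval (aeval s T) q := by
    intro P hP
    obtain ⟨q, hq⟩ := hmono P hP
    refine ⟨q, fun s hs => ?_⟩
    obtain ⟨σ, rfl⟩ := conj ha (mem_SS.1 hs)
    have := congrArg σ hq
    rw [aeval_sigma, aeval_sigmaZ, aeval_sigma] at this
    exact this
  have hinj : ∀ k ∈ SS, ∀ l ∈ SS, aeval k T = aeval l T → k = l := by
    obtain ⟨q, hq⟩ := hmono' X (by rw [aeval_X]; exact integral_S (n := 135) (by norm_num) ha)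
    intro k hk l hl h
    have h1 := hq k hk
    have h2 := hq l hl
    rw [aeval_X] at h1 h2
    rw [h1, h2, h]
  have cint : ∀ c ∈ CC, IsIntegral ℤ c := fun c hc => integral_S (n := 9) (by norm_num) (mem_CC.1 hc)
  have pint : ∀ c ∈ CC, IsIntegral ℤ (ph c) := fun c hc => ph_integral (mem_CC.1 hc)
  have hc₀ : a ^ 15 ∈ CC := pow_mem haS
  obtain ⟨H, hH⟩ := to_int (f := GG T) (fun i hi c hc => GG_int hTS hi hc) (fun σ i _ c _ => GG_sigma T σ i c)
  obtain ⟨F, hF⟩ := to_int (f := fun i c => ph (i ^ 15) - ph c)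
    (fun i hi c hc => (pint _ (pow_mem hi)).sub (pint c hc))
    (fun σ i _ c _ => by rw [map_sub, ph_sigma, ph_sigma, map_pow])
  have hHne : PP (GG T) ≠ 0 := by
    refine PP_ne _ (fun i hi c hc hne => ?_)
    rw [GG, Finset.prod_ne_zero_iff]
    intro k hk h
    have := hinj i hi k (mem_of_cluster hc hk) (sub_eq_zero.1 h)
    rw [mem_rt (by norm_num)] at hk
    exact hne (by rw [this, hk])
  have hH0 : H ≠ 0 := by
    rintro rfl
    exact hHne (by rw [hH]; simp)
  obtain ⟨Phi, hPhi⟩ := exists_Phi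
  obtain ⟨W, hW⟩ := exists_W
  let G : ℤ := 9 ^ 135 * 2214 ^ 120
  have hG : PP (fun i c => i ^ 15 - c) = (G : Om) := by
    rw [PP_gamma]
    simp only [G]
    rw [Int.cast_mul, Int.cast_pow, Int.cast_pow]
    rfl
  have hG0 : G ≠ 0 := mul_ne_zero (pow_ne_zero _ (by norm_num)) (pow_ne_zero _ (by norm_num))
  have hrel : F * 3 ^ 390 = AA.det ^ 30 * G := by
    have := PP_ph
    rw [hF, hG] at this
    have e : ((F * 3 ^ 390 : ℤ) : Om) = ((AA.det ^ 30 * G : ℤ) : Om) := by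
      rw [Int.cast_mul, Int.cast_pow, Int.cast_mul, Int.cast_pow]
      exact this
    exact_mod_cast e
  have hF0 : F ≠ 0 := by
    rintro rfl
    rw [zero_mul] at hrel
    exact mul_ne_zero (pow_ne_zero _ AA_det_ne) hG0 hrel.symm
  -- divisibilities
  have d1 : H ∣ G := by
    obtain ⟨z, hz, e⟩ := PP_Dv (GG T) (fun i c => i ^ 15 - c) (fun i hi c hc => by
      have := claimA haS hTS hinj hmono' X (fun c hc => by rw [aeval_X]; exact cint c hc) hi hc
      rw [aeval_X, aeval_X] at this
      exact this)
    rw [hG, hH] at e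
    exact int_dvd_of_integral hH0 hz e
  have d2 : H ∣ F := by
    obtain ⟨z, hz, e⟩ := PP_Dv (GG T) (fun i c => ph (i ^ 15) - ph c) (fun i hi c hc => by
      have := claimA haS hTS hinj hmono' Phi (fun c hc => by rw [← hPhi]; exact pint c hc) hi hc
      rw [← hPhi, ← hPhi] at this
      exact this)
    rw [hF, hH] at e
    exact int_dvd_of_integral hH0 hz e
  have dB : ∀ (q : ℕ) (_ : q.Prime) (x : Om → Om) (_ : ∀ c ∈ CC, IsIntegral ℤ (x c))
      (_ : ∀ (σ : Om ≃ₐ[ℚ] Om) (c : Om), σ (x c) = x (σ c)) (_ : Mx q (x (a ^ 15)))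
      (W : ℚ[X]) (_ : ∀ c ∈ CC, c = aeval (x c) W) (N : ℤ) (_ : N ≠ 0)
      (_ : PP (fun i c => x (i ^ 15) - x c) = N), ∃ n : ℤ, ¬ (q : ℤ) ∣ n ∧ N ∣ n * H := by
    intro q hq x hx hxs hM W hW N hN hPN
    obtain ⟨n, hn, hdv⟩ := claimB hTS hq x hx hxs hc₀ hM W hW
    refine ⟨n ^ 1080, fun h => hn ((Nat.prime_iff_prime_int.1 hq).dvd_of_dvd_pow h), ?_⟩
    obtain ⟨z, hz, e⟩ := PP_Dv (fun i c => x (i ^ 15) - x c) (fun i c => n * GG T i c) hdv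
    rw [PP_const_mul, hPN, hH] at e
    refine int_dvd_of_integral hN hz ?_
    rw [Int.cast_mul, Int.cast_pow]
    exact e
  have c9 : (a ^ 15) ^ 9 = 2214 := mem_CC.1 hc₀
  obtain ⟨n2, hn2, e2⟩ := dB 2 Nat.prime_two (fun c => c) cint (fun _ _ => rfl)
    (eis (n := 9) Nat.prime_two (by norm_num) 1107 (by norm_num) (by norm_num) c9) X
    (fun c _ => by rw [aeval_X]) G hG0 hG
  obtain ⟨n41, hn41, e41⟩ := dB 41 (by norm_num) (fun c => c) cint (fun _ _ => rfl)
    (eis (n := 9) (by norm_num) (by norm_num) 54 (by norm_num) (by norm_num) c9) X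
    (fun c _ => by rw [aeval_X]) G hG0 hG
  obtain ⟨n3, hn3, e3⟩ := dB 3 Nat.prime_three ph pint ph_sigma (Mx_ph c9) W
    (fun c hc => hW c (mem_CC.1 hc)) F hF0 hF
  obtain ⟨Qt, hQt⟩ := d1
  obtain ⟨Qf, hQf⟩ := d2
  have hloc : (41 : ℤ) ∣ Qt - 1 := by
    refine local41 haS hTS hHne Qt ?_
    rw [hG, hH, hQt, Int.cast_mul]
  exact arith hH0 rfl hQt hQf e2 e41 e3 hn2 hn41 hn3 AA_det hrel hloc

end Ex17


/-- The polynomial `f(x) = x^135 - C 2214` is irreducible over `ℚ`, and the pure number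
field `K = ℚ(α)`, where `α` is a complex root of `f`, is not monogenic. -/
theorem example_17
    {K : Type*} [Field K] [NumberField K]
    (α : K)
    (hroot : Polynomial.aeval α ((X : ℤ[X]) ^ 135 - C 2214) = 0)
    (hgen : Algebra.adjoin ℚ {α} = ⊤) :
    Irreducible (((X : ℤ[X]) ^ 135 - C 2214).map (Int.castRingHom ℚ)) ∧
      ¬ ∃ θ : NumberField.RingOfIntegers K, Algebra.adjoin ℤ {θ} = ⊤ := by
  refine ⟨Ex17.irr_Q, ?_⟩
  rintro ⟨θ, hθ⟩
  have hα : α ^ 135 = 2214 := by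
    rw [map_sub, map_pow, aeval_X, aeval_C, sub_eq_zero] at hroot
    rw [hroot]; exact map_ofNat (algebraMap ℤ K) 2214
  let ι : K →ₐ[ℚ] Ex17.Om := IsAlgClosed.lift
  let ιZ : K →ₐ[ℤ] Ex17.Om := ι.restrictScalars ℤ
  have ha : (ι α) ^ 135 = 2214 := by
    rw [← map_pow, hα]; exact map_ofNat ι 2214
  obtain ⟨T, hT⟩ : ∃ T : ℚ[X], aeval α T = (θ : K) := by
    have : (θ : K) ∈ Algebra.adjoin ℚ {α} := by rw [hgen]; trivial
    rw [Algebra.adjoin_singleton_eq_range_aeval] at this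
    exact this
  have hιT : aeval (ι α) T = ι (θ : K) := by rw [aeval_algHom_apply, hT]
  refine Ex17.core ha T ?_ ?_
  · rw [hιT]
    exact (NumberField.RingOfIntegers.isIntegral_coe θ).map ιZ
  · intro P hP
    have hPK : IsIntegral ℤ (aeval α P) := by
      rw [aeval_algHom_apply] at hP
      exact (isIntegral_algHom_iff ιZ ι.injective).1 hP
    have hz : (⟨aeval α P, hPK⟩ : NumberField.RingOfIntegers K) ∈ Algebra.adjoin ℤ {θ} := by
      rw [hθ]; trivial
    rw [Algebra.adjoin_singleton_eq_range_aeval] at hz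
    obtain ⟨q, hq⟩ := hz
    refine ⟨q, ?_⟩
    have h1 : aeval (θ : K) q = aeval α P := by
      have := congrArg (algebraMap (NumberField.RingOfIntegers K) K) hq
      change algebraMap _ K (aeval θ q) = aeval α P at this
      rw [← this]
      exact aeval_algebraMap_apply K θ q
    rw [hιT, aeval_algHom_apply, ← h1]
    exact (aeval_algHom_apply ιZ (θ : K) q).symm
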